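/- Let n ≥ 1, 1 ≤ p < ∞, 0 < T < ∞, let i ≥ 0 be an integer, and let (φ′,ψ′) be a Littlewood–Paley family on ℝⁿ. There exists C > 0 (depending only on n, p, T, i, φ′, ψ′) such that for every Schwartz function f on ℝⁿ, the heat extension u(X,t) = (Γ(·,t)*f)(X) satisfies ‖u‖_{W^{2i,i}_p(ℝⁿ_T)} ≤ C·B_{2i−2/p, p}(f). -/

import Mathlib

noncomputable section

open MeasureTheory Real Complex
open scoped ENNReal NNReal Real BigOperators

/-- Euclidean space `ℝⁿ`. -/
abbrev Rn (n : ℕ) : Type := EuclideanSpace ℝ (Fin n)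

/-- The space `ℝ^{n+1} = ℝⁿ × ℝ`, points written `(X, t)`. -/
abbrev Rn1 (n : ℕ) : Type := EuclideanSpace ℝ (Fin n) × ℝ

/-- Fourier transform on `ℝ^{n+1}`:
`𝓕f(ξ,τ) = ∫ e^{−2πi(X·ξ + tτ)} f(X,t) dX dt`. -/
def FT1 {n : ℕ} (f : Rn1 n → ℂ) (q : Rn1 n) : ℂ :=
  ∫ p : Rn1 n,
    Complex.exp (-(2 * (π : ℂ) * Complex.I) *
      (((∑ k, p.1 k * q.1 k) + p.2 * q.2 : ℝ) : ℂ)) * f p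

/-- Inverse Fourier transform on `ℝ^{n+1}`. -/
def IFT1 {n : ℕ} (f : Rn1 n → ℂ) (x : Rn1 n) : ℂ :=
  ∫ q : Rn1 n,
    Complex.exp ((2 * (π : ℂ) * Complex.I) *
      (((∑ k, q.1 k * x.1 k) + q.2 * x.2 : ℝ) : ℂ)) * f q

/-- The Fourier multiplier operator `f ↦ 𝓕⁻¹(m · 𝓕 f)` on `ℝ^{n+1}`. -/
def MOp {n : ℕ} (m : Rn1 n → ℂ) (f : Rn1 n → ℂ) : Rn1 n → ℂ :=
  IFT1 (fun q => m q * FT1 f q)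

/-- The symbol `m_α(ξ,τ) = (1 + 4π²|ξ|² + iτ)^{α/2}` (principal branch). -/
def mSym {n : ℕ} (α : ℝ) (q : Rn1 n) : ℂ :=
  (1 + 4 * (π : ℂ) ^ 2 * (‖q.1‖ : ℂ) ^ 2 + Complex.I * (q.2 : ℂ)) ^ ((α : ℂ) / 2)

/-- Partial derivative `∂_{X_k}`. -/
def dX {n : ℕ} (k : Fin n) (f : Rn1 n → ℂ) : Rn1 n → ℂ :=
  fun x => fderiv ℝ f x (EuclideanSpace.single k 1, 0)

/-- Partial derivative `∂_t`. -/
def dT {n : ℕ} (f : Rn1 n → ℂ) : Rn1 n → ℂ :=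
  fun x => fderiv ℝ f x (0, 1)

/-- Iterated spatial derivative `D_X^β` for a multi-index `β`. -/
def dXmulti {n : ℕ} (β : Fin n → ℕ) (f : Rn1 n → ℂ) : Rn1 n → ℂ :=
  (List.finRange n).foldr (fun k g => (dX k)^[β k] g) f

/-- The half time-derivative `D_t^{1/2} f = 𝓕⁻¹(|τ|^{1/2}·𝓕f)`. -/
def halfDt {n : ℕ} (f : Rn1 n → ℂ) : Rn1 n → ℂ :=
  MOp (fun q => ((|q.2| ^ ((1 : ℝ) / 2) : ℝ) : ℂ)) f

/-- The `Lᵖ(ℝ^{n+1})` norm (as a value in `ℝ≥0∞`), `p` a real exponent. -/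
def pNorm {n : ℕ} (p : ℝ) (f : Rn1 n → ℂ) : ℝ≥0∞ :=
  eLpNorm f (ENNReal.ofReal p) volume

/-- Multi-indices `β ∈ ℕⁿ` with `|β| = N`. -/
def multiIdx (n N : ℕ) : Finset (Fin n → ℕ) :=
  (Fintype.piFinset fun _ : Fin n => Finset.range (N + 1)).filter fun β => (∑ k, β k) = N

/-- Convolution on `ℝ^{n+1}`. -/
def conv1 {n : ℕ} (g f : Rn1 n → ℂ) : Rn1 n → ℂ :=
  fun x => ∫ y : Rn1 n, g (x - y) * f y

/-- A parabolic Littlewood–Paley family on `ℝ^{n+1}`. -/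
structure ParabolicLP (n : ℕ) where
  φ : SchwartzMap (Rn1 n) ℂ
  ψ : SchwartzMap (Rn1 n) ℂ
  ft_pos : ∀ q : Rn1 n,
    1 / 2 < ‖q.1‖ + |q.2| ^ ((1 : ℝ) / 2) → ‖q.1‖ + |q.2| ^ ((1 : ℝ) / 2) < 2 →
      0 < (FT1 (⇑φ) q).re ∧ (FT1 (⇑φ) q).im = 0
  ft_supp : ∀ q : Rn1 n,
    ¬(1 / 2 < ‖q.1‖ + |q.2| ^ ((1 : ℝ) / 2) ∧ ‖q.1‖ + |q.2| ^ ((1 : ℝ) / 2) < 2) →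
      FT1 (⇑φ) q = 0
  ft_sum : ∀ q : Rn1 n, q ≠ 0 →
    ∑' i : ℤ, FT1 (⇑φ) (((2 : ℝ) ^ (-i)) • q.1, ((2 : ℝ) ^ (-(2 * i))) * q.2) = 1
  ft_psi : ∀ q : Rn1 n,
    FT1 (⇑ψ) q =
      1 - ∑' i : ℕ,
        FT1 (⇑φ) (((2 : ℝ) ^ (-((i : ℤ) + 1))) • q.1, ((2 : ℝ) ^ (-(2 * ((i : ℤ) + 1)))) * q.2)

/-- The dilate `φ_i`, whose Fourier transform is `𝓕φ(2^{−i}ξ, 2^{−2i}τ)`. -/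
def lpPhi {n : ℕ} (P : ParabolicLP n) (i : ℕ) : Rn1 n → ℂ :=
  fun x => (((2 : ℝ) ^ (i * (n + 2)) : ℝ) : ℂ) *
    P.φ (((2 : ℝ) ^ i) • x.1, ((2 : ℝ) ^ (2 * i)) * x.2)

/-- Parabolic Besov norm `N_{s,p}(f)` on `ℝ^{n+1}`, `1 ≤ p < ∞`. -/
def pBesov {n : ℕ} (P : ParabolicLP n) (s p : ℝ) (f : Rn1 n → ℂ) : ℝ≥0∞ :=
  eLpNorm (conv1 (⇑P.ψ) f) (ENNReal.ofReal p) volume +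
  (∑' i : ℕ,
    (ENNReal.ofReal ((2 : ℝ) ^ (s * ((i : ℝ) + 1))) *
      eLpNorm (conv1 (lpPhi P (i + 1)) f) (ENNReal.ofReal p) volume) ^ p) ^ (1 / p)

/-- Parabolic Besov norm `N_{s,∞}(f)` on `ℝ^{n+1}`. -/
def pBesovInf {n : ℕ} (P : ParabolicLP n) (s : ℝ) (f : Rn1 n → ℂ) : ℝ≥0∞ :=
  max (eLpNorm (conv1 (⇑P.ψ) f) ⊤ volume)
    (⨆ i : ℕ, ENNReal.ofReal ((2 : ℝ) ^ (s * ((i : ℝ) + 1))) *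
      eLpNorm (conv1 (lpPhi P (i + 1)) f) ⊤ volume)

/-- The time interval `(0, T)` for `0 < T ≤ ∞`. -/
def tSet (T : ℝ≥0∞) : Set ℝ := {t : ℝ | 0 < t ∧ ENNReal.ofReal t < T}

/-- Lebesgue measure restricted to the strip `ℝⁿ × (0,T)`. -/
def stripMeasure (n : ℕ) (T : ℝ≥0∞) : Measure (Rn1 n) :=
  volume.restrict {x : Rn1 n | x.2 ∈ tSet T}

/-- The parabolic Sobolev norm `‖g‖_{W^{2i,i}_p(ℝⁿ_T)}`. -/
def wNorm {n : ℕ} (i : ℕ) (p : ℝ) (T : ℝ≥0∞) (g : Rn1 n → ℂ) : ℝ≥0∞ :=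
  ∑ l ∈ Finset.range (i + 1),
    ∑ β ∈ (Fintype.piFinset fun _ : Fin n => Finset.range (2 * i + 1)).filter
        (fun β => (∑ k, β k) + 2 * l ≤ 2 * i),
      eLpNorm (dXmulti β (dT^[l] g)) (ENNReal.ofReal p) (stripMeasure n T)

/-- Time-regularity seminorm `[g]_{t,β,p,T}`. -/
def semT {n : ℕ} (b p : ℝ) (T : ℝ≥0∞) (g : Rn1 n → ℂ) : ℝ≥0∞ :=
  (∫⁻ X : Rn n, ∫⁻ t in tSet T, ∫⁻ s in tSet T,
      ENNReal.ofReal (‖g (X, t) - g (X, s)‖ ^ p / |t - s| ^ (1 + p * b / 2))) ^ (1 / p)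

/-- Space-regularity seminorm `[g]_{x,β,p,T}`. -/
def semX {n : ℕ} (b p : ℝ) (T : ℝ≥0∞) (g : Rn1 n → ℂ) : ℝ≥0∞ :=
  (∫⁻ t in tSet T, ∫⁻ X : Rn n, ∫⁻ Y : Rn n,
      ENNReal.ofReal (‖g (X + Y, t) - 2 * g (X, t) + g (X - Y, t)‖ ^ p /
        ‖Y‖ ^ ((n : ℝ) + p * b))) ^ (1 / p)

/-- The parabolic Besov norm `‖g‖_{B^{α,α/2}_p(ℝⁿ_T)}`, formed with index `i` where
`2i < α < 2i+2`. -/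
def pbNorm {n : ℕ} (i : ℕ) (α p : ℝ) (T : ℝ≥0∞) (g : Rn1 n → ℂ) : ℝ≥0∞ :=
  wNorm i p T g +
  ∑ l ∈ Finset.range (i + 1),
    ∑ β ∈ (Fintype.piFinset fun _ : Fin n => Finset.range (2 * i + 1)).filter
        (fun β => (∑ k, β k) + 2 * l = 2 * i),
      (semT (α - 2 * i) p T (dXmulti β (dT^[l] g)) +
        semX (α - 2 * i) p T (dXmulti β (dT^[l] g)))

/-- Fourier transform on `ℝⁿ`. -/
def FTn {n : ℕ} (f : Rn n → ℂ) (ξ : Rn n) : ℂ :=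
  ∫ x : Rn n, Complex.exp (-(2 * (π : ℂ) * Complex.I) * (((∑ k, x k * ξ k : ℝ)) : ℂ)) * f x

/-- Inverse Fourier transform on `ℝⁿ`. -/
def IFTn {n : ℕ} (f : Rn n → ℂ) (x : Rn n) : ℂ :=
  ∫ ξ : Rn n, Complex.exp ((2 * (π : ℂ) * Complex.I) * (((∑ k, ξ k * x k : ℝ)) : ℂ)) * f ξ

/-- Convolution on `ℝⁿ`. -/
def convn {n : ℕ} (g f : Rn n → ℂ) : Rn n → ℂ := fun x => ∫ y : Rn n, g (x - y) * f y

/-- A Littlewood–Paley family on `ℝⁿ`. -/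
structure LPFamily (n : ℕ) where
  φ : SchwartzMap (Rn n) ℂ
  ψ : SchwartzMap (Rn n) ℂ
  ft_pos : ∀ ξ : Rn n, 1 / 2 < ‖ξ‖ → ‖ξ‖ < 2 →
    0 < (FTn (⇑φ) ξ).re ∧ (FTn (⇑φ) ξ).im = 0
  ft_supp : ∀ ξ : Rn n, ¬(1 / 2 < ‖ξ‖ ∧ ‖ξ‖ < 2) → FTn (⇑φ) ξ = 0
  ft_sum : ∀ ξ : Rn n, ξ ≠ 0 → ∑' i : ℤ, FTn (⇑φ) (((2 : ℝ) ^ (-i)) • ξ) = 1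
  ft_psi : ∀ ξ : Rn n,
    FTn (⇑ψ) ξ = 1 - ∑' i : ℕ, FTn (⇑φ) (((2 : ℝ) ^ (-((i : ℤ) + 1))) • ξ)

/-- The dilate `φ′_i(x) = 2^{in} φ′(2^i x)`. -/
def lpPhin {n : ℕ} (P : LPFamily n) (i : ℕ) : Rn n → ℂ :=
  fun x => (((2 : ℝ) ^ (i * n) : ℝ) : ℂ) * P.φ (((2 : ℝ) ^ i) • x)

/-- Besov norm `B_{s,p}(f)` on `ℝⁿ`, `1 ≤ p < ∞`. -/
def besovN {n : ℕ} (P : LPFamily n) (s p : ℝ) (f : Rn n → ℂ) : ℝ≥0∞ :=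
  eLpNorm (convn (⇑P.ψ) f) (ENNReal.ofReal p) volume +
  (∑' i : ℕ,
    (ENNReal.ofReal ((2 : ℝ) ^ (s * ((i : ℝ) + 1))) *
      eLpNorm (convn (lpPhin P (i + 1)) f) (ENNReal.ofReal p) volume) ^ p) ^ (1 / p)

/-- The heat kernel `Γ(X,t)` on `ℝⁿ` (zero for `t ≤ 0`). -/
def heatKer (n : ℕ) (X : Rn n) (t : ℝ) : ℝ :=
  if 0 < t then (4 * π * t) ^ (-(n : ℝ) / 2) * Real.exp (-‖X‖ ^ 2 / (4 * t)) else 0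

/-- The heat extension `u(X,t) = ∫ Γ(X−Y,t) f(Y) dY`. -/
def heatExt {n : ℕ} (f : Rn n → ℂ) : Rn1 n → ℂ :=
  fun x => ∫ Y : Rn n, (heatKer n (x.1 - Y) x.2 : ℂ) * f Y

section

open Filter Topology
open scoped FourierTransform SchwartzMap InnerProductSpace

/-- Polynomials are dominated by Gaussians. -/
lemma exists_pow_mul_exp_neg_mul_sq_le {b : ℝ} (hb : 0 < b) (N : ℕ) :
    ∃ C : ℝ, ∀ r : ℝ, 0 ≤ r → (1 + r) ^ N * Real.exp (-b * r ^ 2) ≤ C := by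
  refine ⟨N.factorial / (2 * b) ^ N * Real.exp (3 * b), fun r hr => ?_⟩
  have h1 : (2 * b * (1 + r)) ^ N / N.factorial ≤ Real.exp (2 * b * (1 + r)) :=
    Real.pow_div_factorial_le_exp _ (by positivity) N
  have h2 : (1 + r) ^ N ≤ N.factorial / (2 * b) ^ N * Real.exp (2 * b * (1 + r)) := by
    rw [mul_pow] at h1
    have : (1 + r) ^ N
        = N.factorial / (2 * b) ^ N * ((2 * b) ^ N * (1 + r) ^ N / N.factorial) := by
      field_simp
    rw [this]
    gcongr
  calc (1 + r) ^ N * Real.exp (-b * r ^ 2)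
      ≤ N.factorial / (2 * b) ^ N * Real.exp (2 * b * (1 + r)) * Real.exp (-b * r ^ 2) := by
        gcongr
    _ = N.factorial / (2 * b) ^ N * Real.exp (2 * b * (1 + r) + -b * r ^ 2) := by
        rw [Real.exp_add, mul_assoc]
    _ ≤ _ := by
        gcongr
        nlinarith [sq_nonneg (r - 1)]

/-- Gaussians are Schwartz functions. -/
lemma exists_schwartzMap_gaussian (E : Type*) [NormedAddCommGroup E] [InnerProductSpace ℝ E]
    {b : ℝ} (hb : 0 < b) :
    ∃ G : 𝓢(E, ℂ), ∀ x, G x = ((Real.exp (-b * ‖x‖ ^ 2) : ℝ) : ℂ) := by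
  set f : E → ℝ := fun x => -b * ‖x‖ ^ 2 with hf
  have hft : f.HasTemperateGrowth :=
    (Function.HasTemperateGrowth.const (-b)).mul (Function.hasTemperateGrowth_norm_sq E)
  have hsm : ContDiff ℝ ((⊤ : ℕ∞) : WithTop ℕ∞) (Real.exp ∘ f) := Real.contDiff_exp.comp hft.1
  refine ⟨⟨fun x => ((Real.exp (f x) : ℝ) : ℂ), Complex.ofRealCLM.contDiff.comp hsm, ?_⟩,
    fun x => rfl⟩
  intro k n
  obtain ⟨l, C, hC, hbd⟩ := hft.norm_iteratedFDeriv_le_uniform n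
  obtain ⟨C', hC'⟩ := exists_pow_mul_exp_neg_mul_sq_le hb (k + l * n)
  refine ⟨n.factorial * (C + 1) ^ n * C', fun x => ?_⟩
  have h1 : ‖iteratedFDeriv ℝ n (fun x => ((Real.exp (f x) : ℝ) : ℂ)) x‖
      = ‖iteratedFDeriv ℝ n (Real.exp ∘ f) x‖ :=
    Complex.ofRealLI.norm_iteratedFDeriv_comp_left (hsm.contDiffAt) (mod_cast le_top)
  have h2 : ‖iteratedFDeriv ℝ n (Real.exp ∘ f) x‖
      ≤ n.factorial * Real.exp (f x) * ((C + 1) * (1 + ‖x‖) ^ l) ^ n := by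
    refine norm_iteratedFDeriv_comp_le (N := ((⊤ : ℕ∞) : WithTop ℕ∞)) Real.contDiff_exp hft.1
      (mod_cast le_top) x ?_ ?_
    · intro i _
      rw [norm_iteratedFDeriv_eq_norm_iteratedDeriv, iteratedDeriv_eq_iterate,
        Real.iter_deriv_exp, Real.norm_of_nonneg (Real.exp_pos _).le]
    · intro i hi hin
      have hone : 1 ≤ (C + 1) * (1 + ‖x‖) ^ l := by
        have : (1 : ℝ) ≤ (1 + ‖x‖) ^ l := one_le_pow₀ (by linarith [norm_nonneg x])
        nlinarith
      calc ‖iteratedFDeriv ℝ i f x‖ ≤ C * (1 + ‖x‖) ^ l := hbd i hin x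
        _ ≤ (C + 1) * (1 + ‖x‖) ^ l := by gcongr; linarith
        _ ≤ _ := le_self_pow₀ hone (by omega)
  change ‖x‖ ^ k * ‖iteratedFDeriv ℝ n (fun x => ((Real.exp (f x) : ℝ) : ℂ)) x‖ ≤ _
  rw [h1]
  calc ‖x‖ ^ k * ‖iteratedFDeriv ℝ n (Real.exp ∘ f) x‖
      ≤ (1 + ‖x‖) ^ k * (n.factorial * Real.exp (f x) * ((C + 1) * (1 + ‖x‖) ^ l) ^ n) := by
        gcongr
        linarith
    _ = n.factorial * (C + 1) ^ n * ((1 + ‖x‖) ^ (k + l * n) * Real.exp (-b * ‖x‖ ^ 2)) := by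
        rw [mul_pow, ← pow_mul, pow_add]; simp only [hf]; ring
    _ ≤ _ := by
        gcongr
        exact hC' _ (norm_nonneg x)

section Convolution

variable {V : Type*} [NormedAddCommGroup V] [InnerProductSpace ℝ V] [FiniteDimensional ℝ V]
  [MeasurableSpace V] [BorelSpace V]

lemma integrable_cexp_inner_mul {h : V → ℂ} (hh : Integrable h) (x : V) :
    Integrable fun ξ => cexp (↑(2 * π * ⟪ξ, x⟫_ℝ) * I) * h ξ := by
  refine hh.bdd_mul (c := 1) (by fun_prop) (.of_forall fun ξ => ?_)
  rw [Complex.norm_exp_ofReal_mul_I]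

/-- A dilated Fourier multiplier `𝓕 K (c · )` acts by convolution with a dilate of `K`. -/
lemma fourierInv_fourier_smul_mul {K h : V → ℂ} (hK : Integrable K) (hh : Integrable h)
    (c : ℝ) (x : V) :
    𝓕⁻ (fun ξ => 𝓕 K (c • ξ) * h ξ) x = ∫ y, K y * 𝓕⁻ h (x - c • y) := by
  have key := VectorFourier.integral_fourierIntegral_smul_eq_flip (e := Real.fourierChar)
    (μ := (volume : Measure V)) (ν := (volume : Measure V)) (L := c • innerₗ V) (f := K)
    (g := fun ξ => cexp (↑(2 * π * ⟪ξ, x⟫_ℝ) * I) * h ξ) Real.continuous_fourierChar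
    (by simp only [LinearMap.smul_apply, innerₗ_apply_apply]; fun_prop) hK
    (integrable_cexp_inner_mul hh x)
  rw [Real.fourierInv_eq']
  refine Eq.trans ?_ (key.trans ?_)
  · congr 1
    ext ξ
    simp only [Real.fourier_eq', VectorFourier.fourierIntegral, smul_eq_mul]
    rw [← mul_assoc, mul_comm (cexp _), mul_assoc]
    congr 2
    ext v
    simp only [LinearMap.smul_apply, innerₗ_apply_apply, Circle.smul_def, Real.fourierChar_apply,
      inner_smul_right, smul_eq_mul]
    congr 2
    push_cast
    ring
  · congr 1
    ext y
    simp only [VectorFourier.fourierIntegral, smul_eq_mul, Real.fourierInv_eq']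
    congr 2
    ext ξ
    simp only [LinearMap.flip_apply, LinearMap.smul_apply, innerₗ_apply_apply, Circle.smul_def,
      Real.fourierChar_apply, smul_eq_mul, inner_sub_right, inner_smul_right]
    rw [← mul_assoc, ← Complex.exp_add, real_inner_comm y]
    congr 2
    push_cast
    ring

/-- Hölder's inequality for an integral with a weight. -/
lemma lintegral_mul_rpow_le {α : Type*} [MeasurableSpace α] {μ : Measure α} {p : ℝ} (hp : 1 ≤ p)
    {k g : α → ℝ≥0∞} (hk : AEMeasurable k μ) (hg : AEMeasurable g μ) :
    (∫⁻ y, k y * g y ∂μ) ^ p ≤ (∫⁻ y, k y ∂μ) ^ (p - 1) * ∫⁻ y, k y * g y ^ p ∂μ := by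
  rcases hp.eq_or_lt with rfl | hp1
  · simp
  have hp0 : 0 < p := by linarith
  set q := p.conjExponent
  have hpq : p.HolderConjugate q := Real.HolderConjugate.conjExponent hp1
  have hq0 : 0 < q := hpq.symm.pos
  have h : ∫⁻ y, k y ^ (1 / q) * (k y ^ (1 / p) * g y) ∂μ
      ≤ (∫⁻ y, (k y ^ (1 / q)) ^ q ∂μ) ^ (1 / q)
        * (∫⁻ y, (k y ^ (1 / p) * g y) ^ p ∂μ) ^ (1 / p) :=
    ENNReal.lintegral_mul_le_Lp_mul_Lq μ hpq.symm (hk.pow_const (1 / q))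
      ((hk.pow_const (1 / p)).mul hg)
  have e1 : ∀ y, k y ^ (1 / q) * (k y ^ (1 / p) * g y) = k y * g y := by
    intro y
    rw [← mul_assoc, ← ENNReal.rpow_add_of_nonneg _ _ (by positivity) (by positivity)]
    have : 1 / q + 1 / p = 1 := by
      have := hpq.symm.inv_add_inv_eq_one
      simpa using this
    rw [this, ENNReal.rpow_one]
  have e2 : ∀ y, (k y ^ (1 / q)) ^ q = k y := fun y => by
    rw [← ENNReal.rpow_mul, one_div_mul_cancel hq0.ne', ENNReal.rpow_one]
  have e3 : ∀ y, (k y ^ (1 / p) * g y) ^ p = k y * g y ^ p := fun y => by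
    rw [ENNReal.mul_rpow_of_nonneg _ _ hp0.le, ← ENNReal.rpow_mul, one_div_mul_cancel hp0.ne',
      ENNReal.rpow_one]
  simp only [e1, e2, e3] at h
  calc (∫⁻ y, k y * g y ∂μ) ^ p
      ≤ ((∫⁻ y, k y ∂μ) ^ (1 / q) * (∫⁻ y, k y * g y ^ p ∂μ) ^ (1 / p)) ^ p := by gcongr
    _ = _ := by
      rw [ENNReal.mul_rpow_of_nonneg _ _ hp0.le, ← ENNReal.rpow_mul, ← ENNReal.rpow_mul,
        one_div_mul_cancel hp0.ne', ENNReal.rpow_one]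
      congr 2
      have := hpq.symm.inv_add_inv_eq_one
      have hqi : q⁻¹ = 1 - p⁻¹ := by linarith
      rw [one_div, hqi, sub_mul, inv_mul_cancel₀ hp0.ne', one_mul]

/-- Young's inequality for convolution with a dilate of an integrable kernel. -/
lemma eLpNorm_integral_mul_sub_smul_le {p : ℝ} (hp : 1 ≤ p) {K H : V → ℂ} (hK : Integrable K)
    (hH : Continuous H) (c : ℝ) :
    eLpNorm (fun x => ∫ y, K y * H (x - c • y)) (ENNReal.ofReal p) volume
      ≤ eLpNorm K 1 volume * eLpNorm H (ENNReal.ofReal p) volume := by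
  have hp0 : 0 < p := by linarith
  have hpne : ENNReal.ofReal p ≠ 0 := by simpa using hp0
  rw [eLpNorm_one_eq_lintegral_enorm,
    eLpNorm_eq_lintegral_rpow_enorm_toReal hpne ENNReal.ofReal_ne_top,
    eLpNorm_eq_lintegral_rpow_enorm_toReal hpne ENNReal.ofReal_ne_top, ENNReal.toReal_ofReal hp0.le]
  set A := ∫⁻ y, ‖K y‖ₑ
  set B := ∫⁻ x, ‖H x‖ₑ ^ p
  have hKm : AEMeasurable (fun y => ‖K y‖ₑ) := hK.aestronglyMeasurable.enorm
  have hpt : ∀ x, ‖∫ y, K y * H (x - c • y)‖ₑ ^ p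
      ≤ A ^ (p - 1) * ∫⁻ y, ‖K y‖ₑ * ‖H (x - c • y)‖ₑ ^ p := fun x => by
    calc ‖∫ y, K y * H (x - c • y)‖ₑ ^ p ≤ (∫⁻ y, ‖K y‖ₑ * ‖H (x - c • y)‖ₑ) ^ p := by
          gcongr
          refine (enorm_integral_le_lintegral_enorm _).trans_eq ?_
          simp only [enorm_mul]
      _ ≤ _ := lintegral_mul_rpow_le hp hKm (by fun_prop)
  have hmain : ∫⁻ x, ‖∫ y, K y * H (x - c • y)‖ₑ ^ p ≤ A ^ p * B := by
    calc ∫⁻ x, ‖∫ y, K y * H (x - c • y)‖ₑ ^ p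
        ≤ ∫⁻ x, A ^ (p - 1) * ∫⁻ y, ‖K y‖ₑ * ‖H (x - c • y)‖ₑ ^ p := lintegral_mono hpt
      _ = A ^ (p - 1) * ∫⁻ x, ∫⁻ y, ‖K y‖ₑ * ‖H (x - c • y)‖ₑ ^ p := by
          rw [lintegral_const_mul']
          exact ENNReal.rpow_ne_top_of_nonneg (by linarith) hK.2.ne
      _ = A ^ (p - 1) * ∫⁻ y, ∫⁻ x, ‖K y‖ₑ * ‖H (x - c • y)‖ₑ ^ p := by
          rw [lintegral_lintegral_swap]
          refine AEMeasurable.mul (hKm.comp_snd) ?_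
          have : Continuous fun z : V × V => H (z.1 - c • z.2) := by fun_prop
          exact (this.measurable.enorm.pow_const p).aemeasurable
      _ = A ^ (p - 1) * ∫⁻ y, ‖K y‖ₑ * B := by
          congr 2
          ext y
          rw [lintegral_const_mul' _ _ enorm_ne_top,
            lintegral_sub_right_eq_self (fun x => ‖H x‖ₑ ^ p) (c • y)]
      _ = A ^ (p - 1) * (A * B) := by
          rw [lintegral_mul_const'' _ hKm]
      _ = A ^ p * B := by
          rw [← mul_assoc]
          congr 1
          conv_lhs => rw [← ENNReal.rpow_one A, ← ENNReal.rpow_mul, one_mul]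
          rw [← ENNReal.rpow_add_of_nonneg _ _ (by linarith) zero_le_one]
          congr 1; ring
  calc _ ≤ (A ^ p * B) ^ (1 / p) := by gcongr
    _ = _ := by
      rw [ENNReal.mul_rpow_of_nonneg _ _ (by positivity), ← ENNReal.rpow_mul,
        mul_one_div_cancel hp0.ne', ENNReal.rpow_one]

lemma continuous_fourierInv {h : V → ℂ} (hh : Integrable h) : Continuous (𝓕⁻ h) := by
  have : 𝓕⁻ h = fun x => 𝓕 h (-x) := by
    ext x
    rw [Real.fourierInv_eq_fourier_neg]
  rw [this]
  exact (VectorFourier.fourierIntegral_continuous Real.continuous_fourierChar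
    (by exact continuous_inner) hh).comp continuous_neg

/-- A dilated Schwartz symbol is an `Lᵖ` multiplier, uniformly in the dilation. -/
lemma eLpNorm_fourierInv_smul_mul_le {p : ℝ} (hp : 1 ≤ p) (a : 𝓢(V, ℂ)) {h : V → ℂ}
    (hh : Integrable h) (c : ℝ) :
    eLpNorm (𝓕⁻ fun ξ => a (c • ξ) * h ξ) (ENNReal.ofReal p) volume
      ≤ eLpNorm (𝓕⁻ (a : V → ℂ)) 1 volume * eLpNorm (𝓕⁻ h) (ENNReal.ofReal p) volume := by
  set k : 𝓢(V, ℂ) := 𝓕⁻ a with hk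
  have hka : (k : V → ℂ) = 𝓕⁻ (a : V → ℂ) := SchwartzMap.fourierInv_coe a
  have ha : (a : V → ℂ) = 𝓕 (k : V → ℂ) := by
    rw [← SchwartzMap.fourier_coe, hk, FourierTransform.fourier_fourierInv_eq]
  have : (𝓕⁻ fun ξ => a (c • ξ) * h ξ) = fun x => ∫ y, k y * 𝓕⁻ h (x - c • y) := by
    ext x
    rw [← fourierInv_fourier_smul_mul k.integrable hh, ← ha]
  rw [this, ← hka]
  exact eLpNorm_integral_mul_sub_smul_le hp k.integrable (continuous_fourierInv hh) c

end Convolution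

section LittlewoodPaley

variable {n : ℕ}

lemma FTn_eq_fourier (f : Rn n → ℂ) : FTn f = 𝓕 f := by
  ext ξ
  simp only [FTn, Real.fourier_eq', PiLp.inner_apply, smul_eq_mul]
  congr 1
  ext x
  congr 2
  simp only [RCLike.inner_apply, conj_trivial, mul_comm]
  push_cast
  ring

lemma fourierInv_fourier_schwartz (f : 𝓢(Rn n, ℂ)) : 𝓕⁻ (𝓕 (f : Rn n → ℂ)) = f := by
  rw [← SchwartzMap.fourier_coe, ← SchwartzMap.fourierInv_coe,
    FourierTransform.fourierInv_fourier_eq]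

lemma integrable_fourier_schwartz (f : 𝓢(Rn n, ℂ)) : Integrable (𝓕 (f : Rn n → ℂ)) := by
  rw [← SchwartzMap.fourier_coe]
  exact (𝓕 f).integrable

lemma convn_schwartz (k f : 𝓢(Rn n, ℂ)) :
    convn k f = 𝓕⁻ (fun ξ => 𝓕 (k : Rn n → ℂ) ξ * 𝓕 (f : Rn n → ℂ) ξ) := by
  ext x
  have h := fourierInv_fourier_smul_mul k.integrable (integrable_fourier_schwartz f) 1 x
  simp only [one_smul, fourierInv_fourier_schwartz] at h
  rw [h, convn, ← integral_sub_left_eq_self _ volume x]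
  simp

lemma convn_lpPhin (P : LPFamily n) (f : 𝓢(Rn n, ℂ)) (j : ℕ) :
    convn (lpPhin P j) f
      = 𝓕⁻ (fun ξ => 𝓕 (P.φ : Rn n → ℂ) (((2 : ℝ) ^ j)⁻¹ • ξ) * 𝓕 (f : Rn n → ℂ) ξ) := by
  ext x
  have h := fourierInv_fourier_smul_mul P.φ.integrable (integrable_fourier_schwartz f)
    (((2 : ℝ) ^ j)⁻¹) x
  simp only [fourierInv_fourier_schwartz] at h
  have h2 : (0 : ℝ) < 2 ^ j := by positivity
  have hs := Measure.integral_comp_smul (volume : Measure (Rn n))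
    (fun z => P.φ z * f (x - ((2 : ℝ) ^ j)⁻¹ • z)) ((2 : ℝ) ^ j)
  simp only [smul_smul, inv_mul_cancel₀ h2.ne', one_smul] at hs
  rw [h, convn, ← integral_sub_left_eq_self _ volume x]
  simp only [lpPhin, sub_sub_cancel, mul_assoc]
  rw [integral_const_mul, hs, finrank_euclideanSpace_fin, abs_of_pos (by positivity), ← pow_mul,
    Complex.real_smul, ← mul_assoc, ← Complex.ofReal_mul, mul_inv_cancel₀ (by positivity)]
  simp

lemma fourier_phi_eq_zero (P : LPFamily n) {ξ : Rn n} (h : ¬(1 / 2 < ‖ξ‖ ∧ ‖ξ‖ < 2)) :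
    𝓕 (P.φ : Rn n → ℂ) ξ = 0 := by
  rw [← FTn_eq_fourier]
  exact P.ft_supp ξ h

lemma fourier_phi_eq_norm (P : LPFamily n) (ξ : Rn n) :
    𝓕 (P.φ : Rn n → ℂ) ξ = (‖𝓕 (P.φ : Rn n → ℂ) ξ‖ : ℂ) := by
  by_cases h : 1 / 2 < ‖ξ‖ ∧ ‖ξ‖ < 2
  · obtain ⟨h1, h2⟩ := P.ft_pos ξ h.1 h.2
    rw [FTn_eq_fourier] at h1 h2
    have : 𝓕 (P.φ : Rn n → ℂ) ξ = ((𝓕 (P.φ : Rn n → ℂ) ξ).re : ℂ) := by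
      apply Complex.ext <;> simp [h2]
    rw [this, Complex.norm_real, Real.norm_of_nonneg h1.le]
  · simp [fourier_phi_eq_zero P h]

lemma fourier_phi_dyadic_eq_zero (P : LPFamily n) {ξ : Rn n} {N : ℕ} (hN : 2 * ‖ξ‖ ≤ N) {j : ℕ}
    (hj : N ≤ j) : 𝓕 (P.φ : Rn n → ℂ) (((2 : ℝ) ^ (j + 1))⁻¹ • ξ) = 0 := by
  refine fourier_phi_eq_zero P fun h => ?_
  have h1 := h.1
  rw [norm_smul, Real.norm_of_nonneg (by positivity), inv_mul_eq_div,
    lt_div_iff₀ (by positivity)] at h1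
  have h2 : (N : ℝ) < 2 ^ j := by
    have : N < 2 ^ j := hj.trans_lt Nat.lt_two_pow_self
    exact_mod_cast this
  rw [pow_succ] at h1
  linarith [norm_nonneg ξ]

lemma summable_fourier_phi_dyadic (P : LPFamily n) (ξ : Rn n) :
    Summable fun j : ℕ => 𝓕 (P.φ : Rn n → ℂ) (((2 : ℝ) ^ (j + 1))⁻¹ • ξ) := by
  obtain ⟨N, hN⟩ := exists_nat_ge (2 * ‖ξ‖)
  refine summable_of_ne_finset_zero (s := Finset.range N) fun j hj => ?_
  exact fourier_phi_dyadic_eq_zero P hN (by simpa using hj)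

lemma hasSum_fourier_phi_dyadic (P : LPFamily n) (ξ : Rn n) :
    HasSum (fun j : ℕ => 𝓕 (P.φ : Rn n → ℂ) (((2 : ℝ) ^ (j + 1))⁻¹ • ξ))
      (1 - 𝓕 (P.ψ : Rn n → ℂ) ξ) := by
  have h := P.ft_psi ξ
  rw [FTn_eq_fourier, FTn_eq_fourier] at h
  rw [h, sub_sub_cancel]
  convert (summable_fourier_phi_dyadic P ξ).hasSum using 5 with j
  rw [zpow_neg]
  norm_cast

lemma fourier_psi_eq_zero (P : LPFamily n) {ξ : Rn n} (hξ : 2 ≤ ‖ξ‖) :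
    𝓕 (P.ψ : Rn n → ℂ) ξ = 0 := by
  have hne : ξ ≠ 0 := by
    rintro rfl
    norm_num at hξ
  have h := P.ft_sum ξ hne
  rw [FTn_eq_fourier] at h
  have hinj : Function.Injective fun j : ℕ => (j : ℤ) + 1 := fun a b hab => by
    simpa using hab
  rw [← hinj.tsum_eq] at h
  · have h2 := P.ft_psi ξ
    rw [FTn_eq_fourier, FTn_eq_fourier, h, sub_self] at h2
    exact h2
  · intro i hi
    by_contra hi2
    have hi0 : i ≤ 0 := by
      by_contra hpos
      exact hi2 ⟨(i - 1).toNat, by simp only; omega⟩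
    refine hi (fourier_phi_eq_zero P fun h' => ?_)
    have h3 := h'.2
    rw [norm_smul, Real.norm_of_nonneg (by positivity)] at h3
    have : (1 : ℝ) ≤ 2 ^ (-i) := one_le_zpow₀ (by norm_num) (by omega)
    nlinarith [norm_nonneg ξ]

end LittlewoodPaley

section HeatFourier

variable {n : ℕ}

/-- The linear phase `2πi⟨ξ,X⟩ − 4π²|ξ|²t` of the heat semigroup. -/
def heatPhase (ξ : Rn n) : Rn1 n →L[ℝ] ℂ :=
  (2 * π * I : ℂ) • (Complex.ofRealCLM ∘L innerSL ℝ ξ ∘L ContinuousLinearMap.fst ℝ (Rn n) ℝ)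
    - (4 * π ^ 2 * ‖ξ‖ ^ 2 : ℝ) • (Complex.ofRealCLM ∘L ContinuousLinearMap.snd ℝ (Rn n) ℝ)

lemma heatPhase_apply (ξ : Rn n) (x : Rn1 n) :
    heatPhase ξ x = 2 * π * I * (⟪ξ, x.1⟫_ℝ : ℂ) - ((4 * π ^ 2 * ‖ξ‖ ^ 2 * x.2 : ℝ) : ℂ) := by
  simp [heatPhase]

lemma continuous_heatPhase : Continuous (heatPhase (n := n)) := by
  unfold heatPhase
  fun_prop

lemma norm_heatPhase_le (ξ : Rn n) : ‖heatPhase ξ‖ ≤ (2 * π + 4 * π ^ 2) * (1 + ‖ξ‖) ^ 2 := by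
  refine ContinuousLinearMap.opNorm_le_bound _ (by positivity) fun x => ?_
  rw [heatPhase_apply]
  refine (norm_sub_le _ _).trans ?_
  have h1 : ‖(2 * π * I * (⟪ξ, x.1⟫_ℝ : ℂ) : ℂ)‖ ≤ 2 * π * (‖ξ‖ * ‖x‖) := by
    rw [norm_mul, Complex.norm_real]
    have : ‖(2 * π * I : ℂ)‖ = 2 * π := by simp [abs_of_pos Real.pi_pos]
    rw [this]
    gcongr
    exact (norm_inner_le_norm _ _).trans (by gcongr; exact norm_fst_le x)
  have h2 : ‖((4 * π ^ 2 * ‖ξ‖ ^ 2 * x.2 : ℝ) : ℂ)‖ ≤ 4 * π ^ 2 * ‖ξ‖ ^ 2 * ‖x‖ := by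
    rw [Complex.norm_real, norm_mul, Real.norm_of_nonneg (by positivity)]
    gcongr
    exact norm_snd_le x
  refine (add_le_add h1 h2).trans ?_
  have := norm_nonneg ξ
  have h3 : ‖ξ‖ ≤ (1 + ‖ξ‖) ^ 2 := by nlinarith
  have h4 : ‖ξ‖ ^ 2 ≤ (1 + ‖ξ‖) ^ 2 := by nlinarith
  calc 2 * π * (‖ξ‖ * ‖x‖) + 4 * π ^ 2 * ‖ξ‖ ^ 2 * ‖x‖
      ≤ 2 * π * ((1 + ‖ξ‖) ^ 2 * ‖x‖) + 4 * π ^ 2 * (1 + ‖ξ‖) ^ 2 * ‖x‖ := by gcongr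
    _ = _ := by ring

lemma norm_cexp_heatPhase (ξ : Rn n) (x : Rn1 n) :
    ‖cexp (heatPhase ξ x)‖ = Real.exp (-(4 * π ^ 2 * ‖ξ‖ ^ 2 * x.2)) := by
  rw [Complex.norm_exp, heatPhase_apply]
  congr 1
  rw [Complex.sub_re, Complex.ofReal_re]
  simp

lemma norm_cexp_heatPhase_le_one (ξ : Rn n) {x : Rn1 n} (hx : 0 ≤ x.2) :
    ‖cexp (heatPhase ξ x)‖ ≤ 1 := by
  rw [norm_cexp_heatPhase, Real.exp_le_one_iff, neg_nonpos]
  positivity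

/-- All polynomial moments of `h` are integrable. -/
def MomentIntegrable (h : Rn n → ℂ) : Prop :=
  ∀ k : ℕ, Integrable fun ξ => (((1 + ‖ξ‖) ^ k : ℝ) : ℂ) * h ξ

lemma MomentIntegrable.integrable {h : Rn n → ℂ} (hh : MomentIntegrable h) : Integrable h := by
  simpa using hh 0

lemma MomentIntegrable.mul {h q : Rn n → ℂ} (hh : MomentIntegrable h) (hq : Continuous q) {C : ℝ}
    {m : ℕ} (hC : ∀ ξ, ‖q ξ‖ ≤ C * (1 + ‖ξ‖) ^ m) : MomentIntegrable fun ξ => q ξ * h ξ := by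
  intro k
  refine ((hh (k + m)).const_mul (C : ℂ)).mono ?_ (.of_forall fun ξ => ?_)
  · have hk : Continuous fun ξ : Rn n => (((1 + ‖ξ‖) ^ k : ℝ) : ℂ) := by fun_prop
    exact hk.aestronglyMeasurable.mul
      (hq.aestronglyMeasurable.mul hh.integrable.aestronglyMeasurable)
  · have hC0 : 0 ≤ C := by
      have := (norm_nonneg _).trans (hC 0)
      simpa using this
    simp only [norm_mul, Complex.norm_real]
    rw [Real.norm_of_nonneg (by positivity), Real.norm_of_nonneg hC0,
      Real.norm_of_nonneg (by positivity : 0 ≤ (1 + ‖ξ‖) ^ (k + m))]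
    calc (1 + ‖ξ‖) ^ k * (‖q ξ‖ * ‖h ξ‖)
        ≤ (1 + ‖ξ‖) ^ k * ((C * (1 + ‖ξ‖) ^ m) * ‖h ξ‖) := by gcongr; exact hC ξ
      _ = _ := by rw [pow_add]; ring

lemma MomentIntegrable.heatPhase_mul {h : Rn n → ℂ} (hh : MomentIntegrable h) (v : Rn1 n) :
    MomentIntegrable fun ξ => heatPhase ξ v * h ξ := by
  refine hh.mul (C := (2 * π + 4 * π ^ 2) * ‖v‖) (m := 2) ?_ fun ξ => ?_
  · exact continuous_heatPhase.clm_apply continuous_const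
  · refine ((heatPhase ξ).le_opNorm v).trans ?_
    calc ‖heatPhase ξ‖ * ‖v‖ ≤ ((2 * π + 4 * π ^ 2) * (1 + ‖ξ‖) ^ 2) * ‖v‖ := by
          gcongr; exact norm_heatPhase_le ξ
      _ = _ := by ring

lemma momentIntegrable_schwartz (g : 𝓢(Rn n, ℂ)) : MomentIntegrable g := by
  intro k
  refine (((g.integrable_pow_mul volume 0).add (g.integrable_pow_mul volume k)).const_mul
    ((2 : ℝ) ^ (k - 1))).mono ?_ (.of_forall fun ξ => ?_)
  · exact (by fun_prop : Continuous fun ξ : Rn n => (((1 + ‖ξ‖) ^ k : ℝ) : ℂ)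
      * g ξ).aestronglyMeasurable
  · rw [norm_mul, Complex.norm_real, Real.norm_of_nonneg (by positivity),
      Real.norm_of_nonneg (by simp only [Pi.add_apply]; positivity)]
    have := add_pow_le zero_le_one (norm_nonneg ξ) k
    simp only [Pi.add_apply]
    calc (1 + ‖ξ‖) ^ k * ‖g ξ‖ ≤ (2 ^ (k - 1) * (1 ^ k + ‖ξ‖ ^ k)) * ‖g ξ‖ := by gcongr
      _ = _ := by ring

/-- The heat flow of the function with Fourier transform `h`. -/
def heatFourier (h : Rn n → ℂ) : Rn1 n → ℂ := fun x => ∫ ξ, cexp (heatPhase ξ x) * h ξ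

lemma hasFDerivAt_heatFourier {h : Rn n → ℂ} (hh : MomentIntegrable h) {x : Rn1 n}
    (hx : 0 < x.2) :
    HasFDerivAt (heatFourier h) (∫ ξ, (cexp (heatPhase ξ x) * h ξ) • heatPhase ξ) x := by
  have hopen : IsOpen {y : Rn1 n | 0 < y.2} := isOpen_lt continuous_const continuous_snd
  have hm : ∀ y : Rn1 n, AEStronglyMeasurable (fun ξ => cexp (heatPhase ξ y) * h ξ) := fun y =>
    (Complex.continuous_exp.comp
      (continuous_heatPhase.clm_apply continuous_const)).aestronglyMeasurable.mul
      hh.integrable.aestronglyMeasurable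
  refine hasFDerivAt_integral_of_dominated_of_fderiv_le
    (F' := fun y ξ => (cexp (heatPhase ξ y) * h ξ) • heatPhase ξ)
    (bound := fun ξ => (2 * π + 4 * π ^ 2) * ‖(((1 + ‖ξ‖) ^ 2 : ℝ) : ℂ) * h ξ‖)
    (hopen.mem_nhds hx) (.of_forall hm) ?_ ?_ ?_ ?_ ?_
  · refine hh.integrable.mono (hm x) (.of_forall fun ξ => ?_)
    rw [norm_mul]
    exact mul_le_of_le_one_left (norm_nonneg _) (norm_cexp_heatPhase_le_one ξ hx.le)
  · exact (hm x).smul continuous_heatPhase.aestronglyMeasurable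
  · refine .of_forall fun ξ y hy => ?_
    rw [norm_smul, norm_mul, norm_mul, Complex.norm_real, Real.norm_of_nonneg (by positivity)]
    calc ‖cexp (heatPhase ξ y)‖ * ‖h ξ‖ * ‖heatPhase ξ‖
        ≤ 1 * ‖h ξ‖ * ((2 * π + 4 * π ^ 2) * (1 + ‖ξ‖) ^ 2) := by
          gcongr
          · exact norm_cexp_heatPhase_le_one ξ (le_of_lt hy)
          · exact norm_heatPhase_le ξ
      _ = _ := by ring
  · exact (hh 2).norm.const_mul _
  · refine .of_forall fun ξ y _ => ?_
    have h1 : HasFDerivAt (fun y => cexp (heatPhase ξ y)) (cexp (heatPhase ξ y) • heatPhase ξ) y :=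
      (heatPhase ξ).hasFDerivAt.cexp
    have := h1.mul_const (h ξ)
    rwa [smul_smul, mul_comm (h ξ)] at this

lemma integrable_cexp_heatPhase_mul_smul {h : Rn n → ℂ} (hh : MomentIntegrable h) {x : Rn1 n}
    (hx : 0 < x.2) : Integrable fun ξ => (cexp (heatPhase ξ x) * h ξ) • heatPhase ξ := by
  refine ((hh 2).norm.const_mul (2 * π + 4 * π ^ 2)).mono ?_ (.of_forall fun ξ => ?_)
  · exact ((Complex.continuous_exp.comp
      (continuous_heatPhase.clm_apply continuous_const)).aestronglyMeasurable.mul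
      hh.integrable.aestronglyMeasurable).smul continuous_heatPhase.aestronglyMeasurable
  · rw [norm_smul, norm_mul, norm_mul, norm_norm, norm_mul, Complex.norm_real,
      Real.norm_of_nonneg (by positivity : 0 ≤ (1 + ‖ξ‖) ^ 2),
      Real.norm_of_nonneg (by positivity : 0 ≤ 2 * π + 4 * π ^ 2)]
    calc ‖cexp (heatPhase ξ x)‖ * ‖h ξ‖ * ‖heatPhase ξ‖
        ≤ 1 * ‖h ξ‖ * ((2 * π + 4 * π ^ 2) * (1 + ‖ξ‖) ^ 2) := by
          gcongr
          · exact norm_cexp_heatPhase_le_one ξ hx.le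
          · exact norm_heatPhase_le ξ
      _ = _ := by ring

lemma fderiv_heatFourier {h : Rn n → ℂ} (hh : MomentIntegrable h) {x : Rn1 n} (hx : 0 < x.2)
    (v : Rn1 n) :
    fderiv ℝ (heatFourier h) x v = heatFourier (fun ξ => heatPhase ξ v * h ξ) x := by
  rw [(hasFDerivAt_heatFourier hh hx).fderiv,
    ContinuousLinearMap.integral_apply (integrable_cexp_heatPhase_mul_smul hh hx)]
  refine integral_congr_ae (.of_forall fun ξ => ?_)
  simp only [smul_apply, smul_eq_mul]
  ring

lemma continuousOn_heatFourier {h : Rn n → ℂ} (hh : MomentIntegrable h) :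
    ContinuousOn (heatFourier h) {x | 0 < x.2} := fun _ hx =>
  (hasFDerivAt_heatFourier hh hx).continuousAt.continuousWithinAt

lemma fderiv_eqOn_heatFourier {h : Rn n → ℂ} (hh : MomentIntegrable h) {g : Rn1 n → ℂ}
    (hg : Set.EqOn g (heatFourier h) {x | 0 < x.2}) (v : Rn1 n) :
    Set.EqOn (fun x => fderiv ℝ g x v) (heatFourier fun ξ => heatPhase ξ v * h ξ)
      {x | 0 < x.2} := fun x hx => by
  have hopen : IsOpen {y : Rn1 n | 0 < y.2} := isOpen_lt continuous_const continuous_snd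
  have : g =ᶠ[𝓝 x] heatFourier h := hg.eventuallyEq_of_mem (hopen.mem_nhds hx)
  simp only [this.fderiv_eq]
  exact fderiv_heatFourier hh hx v

lemma iterate_fderiv_eqOn_heatFourier {h : Rn n → ℂ} (hh : MomentIntegrable h) {g : Rn1 n → ℂ}
    (hg : Set.EqOn g (heatFourier h) {x | 0 < x.2}) (v : Rn1 n) (m : ℕ) :
    MomentIntegrable (fun ξ => heatPhase ξ v ^ m * h ξ) ∧
    Set.EqOn ((fun (u : Rn1 n → ℂ) x => fderiv ℝ u x v)^[m] g)
      (heatFourier fun ξ => heatPhase ξ v ^ m * h ξ) {x | 0 < x.2} := by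
  induction m with
  | zero => simpa using ⟨hh, hg⟩
  | succ m ih =>
    rw [Function.iterate_succ_apply']
    have e : (fun ξ => heatPhase ξ v ^ (m + 1) * h ξ)
        = fun ξ => heatPhase ξ v * (heatPhase ξ v ^ m * h ξ) := by
      ext ξ; ring
    rw [e]
    exact ⟨ih.1.heatPhase_mul v, fderiv_eqOn_heatFourier ih.1 ih.2 v⟩

/-- The symbol of `D_X^β D_t^l` on solutions of the heat equation. -/
def heatSymbol (β : Fin n → ℕ) (l : ℕ) (ξ : Rn n) : ℂ :=
  (∏ k, (2 * π * I * (ξ k : ℂ)) ^ β k) * (-((4 * π ^ 2 * ‖ξ‖ ^ 2 : ℝ) : ℂ)) ^ l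

lemma heatSymbol_smul (β : Fin n → ℕ) (l : ℕ) (c : ℝ) (ξ : Rn n) :
    heatSymbol β l (c • ξ) = (c : ℂ) ^ (∑ k, β k + 2 * l) * heatSymbol β l ξ := by
  have h1 : ∀ k, (2 * π * I * ((c • ξ) k : ℂ)) ^ β k
      = (c : ℂ) ^ β k * (2 * π * I * (ξ k : ℂ)) ^ β k := fun k => by
    rw [← mul_pow]
    simp only [PiLp.smul_apply, smul_eq_mul, Complex.ofReal_mul]
    ring
  have h2 : (-((4 * π ^ 2 * ‖c • ξ‖ ^ 2 : ℝ) : ℂ)) ^ l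
      = (c : ℂ) ^ (2 * l) * (-((4 * π ^ 2 * ‖ξ‖ ^ 2 : ℝ) : ℂ)) ^ l := by
    rw [pow_mul, ← mul_pow, norm_smul, mul_pow, Real.norm_eq_abs, sq_abs]
    push_cast
    ring
  simp only [heatSymbol, h1, h2, Finset.prod_mul_distrib, Finset.prod_pow_eq_pow_sum, pow_add]
  ring

lemma dXmulti_iterate_dT_eqOn {h : Rn n → ℂ} (hh : MomentIntegrable h) {g : Rn1 n → ℂ}
    (hg : Set.EqOn g (heatFourier h) {x | 0 < x.2}) (β : Fin n → ℕ) (l : ℕ) :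
    MomentIntegrable (fun ξ => heatSymbol β l ξ * h ξ) ∧
    Set.EqOn (dXmulti β (dT^[l] g)) (heatFourier fun ξ => heatSymbol β l ξ * h ξ)
      {x | 0 < x.2} := by
  have hT : MomentIntegrable (fun ξ => heatPhase ξ (0, 1) ^ l * h ξ) ∧
      Set.EqOn (dT^[l] g) (heatFourier fun ξ => heatPhase ξ (0, 1) ^ l * h ξ) {x | 0 < x.2} :=
    iterate_fderiv_eqOn_heatFourier hh hg (0, 1) l
  have hlist : ∀ L : List (Fin n),
      MomentIntegrable (fun ξ => (L.map fun k => (2 * π * I * (ξ k : ℂ)) ^ β k).prod *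
        (heatPhase ξ (0, 1) ^ l * h ξ)) ∧
      Set.EqOn (L.foldr (fun k g => (dX k)^[β k] g) (dT^[l] g))
        (heatFourier fun ξ => (L.map fun k => (2 * π * I * (ξ k : ℂ)) ^ β k).prod *
          (heatPhase ξ (0, 1) ^ l * h ξ)) {x | 0 < x.2} := by
    intro L
    induction L with
    | nil => simpa using hT
    | cons k L ih =>
      have := iterate_fderiv_eqOn_heatFourier ih.1 ih.2 (EuclideanSpace.single k 1, 0) (β k)
      have e : ∀ ξ : Rn n, heatPhase ξ (EuclideanSpace.single k 1, 0) = 2 * π * I * (ξ k : ℂ) := by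
        intro ξ
        simp [heatPhase_apply, EuclideanSpace.inner_single_right]
      simp only [e, ← mul_assoc] at this
      simp only [List.foldr_cons, List.map_cons, List.prod_cons]
      simp only [← mul_assoc]
      exact this
  have e : ∀ ξ : Rn n, heatSymbol β l ξ * h ξ
      = ((List.finRange n).map fun k => (2 * π * I * (ξ k : ℂ)) ^ β k).prod *
        (heatPhase ξ (0, 1) ^ l * h ξ) := by
    intro ξ
    rw [heatSymbol, mul_assoc]
    congr 1
    simp [heatPhase_apply]
  simp only [e]
  exact hlist _

lemma heatExt_eqOn (f : 𝓢(Rn n, ℂ)) :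
    Set.EqOn (heatExt f) (heatFourier (𝓕 (f : Rn n → ℂ))) {x | 0 < x.2} := by
  rintro ⟨X, t⟩ (ht : 0 < t)
  have hb : 0 < ((4 * π ^ 2 * t : ℝ) : ℂ).re := by
    rw [Complex.ofReal_re]; positivity
  set G : Rn n → ℂ := fun v => cexp (-((4 * π ^ 2 * t : ℝ) : ℂ) * ‖v‖ ^ 2 + 2 * π * I * ⟪X, v⟫_ℝ)
    with hG
  have hGi : Integrable G := GaussianFourier.integrable_cexp_neg_mul_sq_norm_add hb (2 * π * I) X
  have key := VectorFourier.integral_fourierIntegral_smul_eq_flip (e := Real.fourierChar)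
    (μ := (volume : Measure (Rn n))) (ν := (volume : Measure (Rn n))) (L := innerₗ (Rn n)) (f := G)
    (g := f) Real.continuous_fourierChar (by exact continuous_inner) hGi f.integrable
  rw [flip_innerₗ] at key
  change ∫ ξ, 𝓕 G ξ * f ξ = ∫ x, G x * 𝓕 (f : Rn n → ℂ) x at key
  refine Eq.trans ?_ (key.trans ?_)
  · unfold heatExt
    congr 1
    ext Y
    rw [hG, fourier_gaussian_innerProductSpace' hb]
    congr 1
    simp only [heatKer, if_pos ht, finrank_euclideanSpace_fin]
    push_cast
    congr 1
    · rw [Complex.ofReal_cpow (by positivity)]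
      have : (π / (4 * π ^ 2 * t) : ℂ) = ((4 * π * t : ℝ) : ℂ)⁻¹ := by
        push_cast
        have : (π : ℂ) ≠ 0 := by exact_mod_cast Real.pi_ne_zero
        have : (t : ℂ) ≠ 0 := by exact_mod_cast ht.ne'
        field_simp
      rw [this, Complex.inv_cpow, ← Complex.cpow_neg]
      · congr 1
        push_cast
        ring
      · rw [Complex.arg_ofReal_of_nonneg (by positivity)]
        exact Real.pi_ne_zero.symm
    · congr 1
      have : (π : ℂ) ≠ 0 := by exact_mod_cast Real.pi_ne_zero
      have : (t : ℂ) ≠ 0 := by exact_mod_cast ht.ne'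
      field_simp
  · unfold heatFourier
    congr 1
    ext ξ
    simp only [hG]
    rw [heatPhase_apply, real_inner_comm]
    congr 2
    push_cast
    ring

lemma heatFourier_eq_fourierInv (h : Rn n → ℂ) (X : Rn n) (t : ℝ) :
    heatFourier h (X, t)
      = 𝓕⁻ (fun ξ => ((Real.exp (-(4 * π ^ 2) * ‖ξ‖ ^ 2 * t) : ℝ) : ℂ) * h ξ) X := by
  rw [Real.fourierInv_eq', heatFourier]
  congr 1
  ext ξ
  rw [smul_eq_mul, ← mul_assoc, Complex.ofReal_exp, ← Complex.exp_add, heatPhase_apply]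
  congr 2
  push_cast
  ring

end HeatFourier

section Decomposition

variable {n : ℕ}

lemma aestronglyMeasurable_cexp_heatPhase_mul {h : Rn n → ℂ}
    (hh : AEStronglyMeasurable h volume) (x : Rn1 n) :
    AEStronglyMeasurable (fun ξ => cexp (heatPhase ξ x) * h ξ) volume :=
  (Complex.continuous_exp.comp
    (continuous_heatPhase.clm_apply continuous_const)).aestronglyMeasurable.mul hh

lemma integrable_cexp_heatPhase_mul {h : Rn n → ℂ} (hh : Integrable h) {x : Rn1 n}
    (hx : 0 ≤ x.2) : Integrable fun ξ => cexp (heatPhase ξ x) * h ξ := by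
  refine hh.mono (aestronglyMeasurable_cexp_heatPhase_mul hh.aestronglyMeasurable x)
    (.of_forall fun ξ => ?_)
  rw [norm_mul]
  exact mul_le_of_le_one_left (norm_nonneg _) (norm_cexp_heatPhase_le_one ξ hx)

lemma continuous_fourier_schwartz (k : 𝓢(Rn n, ℂ)) : Continuous (𝓕 (k : Rn n → ℂ)) := by
  rw [← SchwartzMap.fourier_coe]
  exact (𝓕 k).continuous

lemma exists_norm_schwartz_le (a : 𝓢(Rn n, ℂ)) : ∃ C, ∀ ξ, ‖a ξ‖ ≤ C := by
  obtain ⟨C, hC⟩ := a.decay 0 0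
  exact ⟨C, fun ξ => by simpa using hC.2 ξ⟩

lemma exists_norm_fourier_schwartz_le (k : 𝓢(Rn n, ℂ)) :
    ∃ C, ∀ ξ, ‖𝓕 (k : Rn n → ℂ) ξ‖ ≤ C := by
  rw [← SchwartzMap.fourier_coe]
  exact exists_norm_schwartz_le _

lemma integrable_schwartz_smul_mul (a : 𝓢(Rn n, ℂ)) (c : ℝ) {h : Rn n → ℂ} (hh : Integrable h) :
    Integrable fun ξ => a (c • ξ) * h ξ := by
  obtain ⟨C, hC⟩ := exists_norm_schwartz_le a
  exact hh.bdd_mul (by fun_prop : Continuous fun ξ => a (c • ξ)).aestronglyMeasurable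
    (.of_forall fun ξ => hC _)

lemma MomentIntegrable.fourier_schwartz_smul_mul (k : 𝓢(Rn n, ℂ)) (c : ℝ) {h : Rn n → ℂ}
    (hh : MomentIntegrable h) : MomentIntegrable fun ξ => 𝓕 (k : Rn n → ℂ) (c • ξ) * h ξ := by
  obtain ⟨C, hC⟩ := exists_norm_fourier_schwartz_le k
  refine hh.mul (C := C) (m := 0)
    ((continuous_fourier_schwartz k).comp (continuous_const_smul c)) fun ξ => ?_
  simpa using hC (c • ξ)

/-- The Littlewood–Paley decomposition of a heat flow. -/
lemma enorm_heatFourier_le (P : LPFamily n) {h : Rn n → ℂ} (hh : Integrable h) {x : Rn1 n}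
    (hx : 0 ≤ x.2) :
    ‖heatFourier h x‖ₑ ≤ ‖heatFourier (fun ξ => 𝓕 (P.ψ : Rn n → ℂ) ξ * h ξ) x‖ₑ +
      ∑' j : ℕ,
        ‖heatFourier (fun ξ => 𝓕 (P.φ : Rn n → ℂ) (((2 : ℝ) ^ (j + 1))⁻¹ • ξ) * h ξ) x‖ₑ := by
  have hψc := continuous_fourier_schwartz P.ψ
  have hψi : Integrable fun ξ => 𝓕 (P.ψ : Rn n → ℂ) ξ * h ξ := by
    obtain ⟨C, hC⟩ := exists_norm_fourier_schwartz_le P.ψ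
    exact hh.bdd_mul hψc.aestronglyMeasurable (.of_forall hC)
  have hnorm : ∀ ξ : Rn n,
      HasSum (fun j : ℕ => ‖𝓕 (P.φ : Rn n → ℂ) (((2 : ℝ) ^ (j + 1))⁻¹ • ξ)‖)
        ‖1 - 𝓕 (P.ψ : Rn n → ℂ) ξ‖ := by
    intro ξ
    have h1 : Summable fun j : ℕ => ‖𝓕 (P.φ : Rn n → ℂ) (((2 : ℝ) ^ (j + 1))⁻¹ • ξ)‖ :=
      (summable_fourier_phi_dyadic P ξ).norm
    have h2 := hasSum_fourier_phi_dyadic P ξ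
    have h3 := Complex.hasSum_ofReal.mpr h1.hasSum
    simp only [← fourier_phi_eq_norm] at h3
    rw [h2.unique h3, Complex.norm_real,
      Real.norm_of_nonneg (tsum_nonneg fun _ => norm_nonneg _)]
    exact h1.hasSum
  have hsum : HasSum
      (fun j : ℕ => heatFourier
        (fun ξ => 𝓕 (P.φ : Rn n → ℂ) (((2 : ℝ) ^ (j + 1))⁻¹ • ξ) * h ξ) x)
      (heatFourier (fun ξ => (1 - 𝓕 (P.ψ : Rn n → ℂ) ξ) * h ξ) x) := by
    refine hasSum_integral_of_dominated_convergence
      (fun j ξ => ‖𝓕 (P.φ : Rn n → ℂ) (((2 : ℝ) ^ (j + 1))⁻¹ • ξ)‖ * ‖h ξ‖) (fun j => ?_)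
      (fun j => .of_forall fun ξ => ?_) (.of_forall fun ξ => (hnorm ξ).summable.mul_right _) ?_
      (.of_forall fun ξ => ?_)
    · exact aestronglyMeasurable_cexp_heatPhase_mul
        (((continuous_fourier_schwartz P.φ).comp
          (continuous_const_smul _)).aestronglyMeasurable.mul hh.aestronglyMeasurable) x
    · rw [norm_mul, norm_mul]
      exact mul_le_of_le_one_left (by positivity) (norm_cexp_heatPhase_le_one ξ hx)
    · simp only [fun ξ => ((hnorm ξ).mul_right ‖h ξ‖).tsum_eq]
      refine (hh.sub hψi).norm.congr (.of_forall fun ξ => ?_)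
      simp only [Pi.sub_apply]
      rw [← norm_mul, sub_mul, one_mul]
    · exact ((hasSum_fourier_phi_dyadic P ξ).mul_right (h ξ)).mul_left _
  have hadd : heatFourier h x = heatFourier (fun ξ => 𝓕 (P.ψ : Rn n → ℂ) ξ * h ξ) x +
      heatFourier (fun ξ => (1 - 𝓕 (P.ψ : Rn n → ℂ) ξ) * h ξ) x := by
    have h2i : Integrable fun ξ => (1 - 𝓕 (P.ψ : Rn n → ℂ) ξ) * h ξ := by
      simp only [sub_mul, one_mul]
      exact hh.sub hψi
    unfold heatFourier
    rw [← integral_add (integrable_cexp_heatPhase_mul hψi hx)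
      (integrable_cexp_heatPhase_mul h2i hx)]
    congr 1
    ext ξ
    ring
  rw [hadd]
  refine (enorm_add_le _ _).trans ?_
  gcongr
  rw [← hsum.tsum_eq]
  exact enorm_tsum_le_tsum_enorm

end Decomposition

section FrequencyPieces

variable {n : ℕ}

/-- The symbol `|ξ|^{2M} e^{-4π²|ξ|²}` is Schwartz. -/
lemma exists_schwartzMap_heat_symbol (n M : ℕ) :
    ∃ a : 𝓢(Rn n, ℂ), ∀ ξ,
      a ξ = (((‖ξ‖ ^ 2) ^ M * Real.exp (-(4 * π ^ 2) * ‖ξ‖ ^ 2) : ℝ) : ℂ) := by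
  obtain ⟨G, hG⟩ := exists_schwartzMap_gaussian (Rn n) (b := 4 * π ^ 2) (by positivity)
  have ht : (fun ξ : Rn n => (‖ξ‖ ^ 2) ^ M).HasTemperateGrowth :=
    (Function.hasTemperateGrowth_norm_sq (Rn n)).pow M
  refine ⟨SchwartzMap.smulLeftCLM ℂ (fun ξ : Rn n => (‖ξ‖ ^ 2) ^ M) G, fun ξ => ?_⟩
  rw [SchwartzMap.smulLeftCLM_apply_apply ht, hG, Complex.real_smul, ← Complex.ofReal_mul]

/-- The symbol `heatSymbol β l ξ / |ξ|^{2M}` agrees with a Schwartz function on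
`1/2 ≤ |ξ| ≤ 2`, and on all of `|ξ| ≤ 2` when `M = 0`. -/
lemma exists_schwartzMap_heatSymbol (β : Fin n → ℕ) (l M : ℕ) :
    ∃ b : 𝓢(Rn n, ℂ), ∀ ξ, ‖ξ‖ ≤ 2 → (1 / 2 ≤ ‖ξ‖ ∨ M = 0) →
      b ξ * (((‖ξ‖ ^ 2) ^ M : ℝ) : ℂ) = heatSymbol β l ξ := by
  let χ : ContDiffBump (0 : Rn n) := ⟨2, 3, by norm_num, by norm_num⟩
  let η : ContDiffBump (0 : Rn n) := ⟨1 / 4, 1 / 2, by norm_num, by norm_num⟩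
  have hpos : ∀ ξ : Rn n, ‖ξ‖ ^ 2 + η ξ ≠ 0 := fun ξ => by
    have h0 : 0 ≤ η ξ := η.nonneg
    rcases eq_or_ne ξ 0 with rfl | hξ
    · rw [η.one_of_mem_closedBall (by simp [η])]
      norm_num
    · have := norm_pos_iff.mpr hξ
      positivity
  set q : Rn n → ℂ := fun ξ =>
    ((χ ξ * ((‖ξ‖ ^ 2 + η ξ)⁻¹) ^ M : ℝ) : ℂ) * heatSymbol β l ξ with hq
  have hsm : ContDiff ℝ ((⊤ : ℕ∞) : WithTop ℕ∞) q := by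
    have h1 : ContDiff ℝ ((⊤ : ℕ∞) : WithTop ℕ∞)
        fun ξ : Rn n => χ ξ * ((‖ξ‖ ^ 2 + η ξ)⁻¹) ^ M :=
      χ.contDiff.mul ((((contDiff_norm_sq ℝ).add η.contDiff).inv hpos).pow M)
    have h2 : ContDiff ℝ ((⊤ : ℕ∞) : WithTop ℕ∞) (heatSymbol (n := n) β l) := by
      unfold heatSymbol
      refine ContDiff.mul (contDiff_prod fun k _ => ?_) ?_
      · have : ContDiff ℝ ((⊤ : ℕ∞) : WithTop ℕ∞) fun ξ : Rn n => (ξ k : ℂ) :=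
          Complex.ofRealCLM.contDiff.comp (EuclideanSpace.proj k : Rn n →L[ℝ] ℝ).contDiff
        exact (contDiff_const.mul this).pow _
      · exact ((Complex.ofRealCLM.contDiff.comp
          (contDiff_const.mul (contDiff_norm_sq ℝ))).neg).pow l
    exact (Complex.ofRealCLM.contDiff.comp h1).mul h2
  have hcs : HasCompactSupport q := by
    refine χ.hasCompactSupport.mono' ?_
    intro ξ hξ
    refine subset_tsupport _ ?_
    rw [Function.mem_support] at hξ ⊢
    contrapose! hξ
    simp [hq, hξ]
  refine ⟨hcs.toSchwartzMap hsm, fun ξ hξ hM => ?_⟩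
  have hχ : χ ξ = 1 := χ.one_of_mem_closedBall (by simpa [χ] using hξ)
  change q ξ * _ = _
  simp only [hq, hχ, one_mul]
  rcases hM with h | rfl
  · have hη : η ξ = 0 := η.zero_of_le_dist (by simpa [η] using h)
    have h0 : ‖ξ‖ ^ 2 ≠ 0 := by
      have : 0 < ‖ξ‖ := lt_of_lt_of_le (by norm_num) h
      positivity
    rw [hη, add_zero, mul_right_comm, ← Complex.ofReal_mul, ← mul_pow, inv_mul_cancel₀ h0]
    simp
  · simp

lemma heat_symbol_factorization {a b : Rn n → ℂ} {β : Fin n → ℕ} {l M : ℕ}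
    (ha : ∀ ξ, a ξ = (((‖ξ‖ ^ 2) ^ M * Real.exp (-(4 * π ^ 2) * ‖ξ‖ ^ 2) : ℝ) : ℂ))
    {R t : ℝ} (hR : 0 < R) (ht : 0 < t) {ξ : Rn n}
    (hb : b (R⁻¹ • ξ) * (((‖R⁻¹ • ξ‖ ^ 2) ^ M : ℝ) : ℂ) = heatSymbol β l (R⁻¹ • ξ)) :
    ((Real.exp (-(4 * π ^ 2) * ‖ξ‖ ^ 2 * t) : ℝ) : ℂ) * heatSymbol β l ξ
      = ((R ^ (∑ k, β k + 2 * l) / (t * R ^ 2) ^ M : ℝ) : ℂ) *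
        (a (√t • ξ) * b (R⁻¹ • ξ)) := by
  have h1 : heatSymbol β l ξ = (R : ℂ) ^ (∑ k, β k + 2 * l) * heatSymbol β l (R⁻¹ • ξ) := by
    rw [← heatSymbol_smul, smul_inv_smul₀ hR.ne']
  have h2 : ‖√t • ξ‖ ^ 2 = ‖ξ‖ ^ 2 * t := by
    rw [norm_smul, mul_pow, Real.norm_of_nonneg (Real.sqrt_nonneg t), Real.sq_sqrt ht.le, mul_comm]
  have h3 : ‖R⁻¹ • ξ‖ ^ 2 = ‖ξ‖ ^ 2 / R ^ 2 := by
    rw [norm_smul, mul_pow, Real.norm_of_nonneg (by positivity)]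
    field_simp
  have hR' : (R : ℂ) ≠ 0 := by exact_mod_cast hR.ne'
  have ht' : (t : ℂ) ≠ 0 := by exact_mod_cast ht.ne'
  rw [h1, ← hb, ha, h2, h3, ← mul_assoc (-(4 * π ^ 2))]
  push_cast
  simp only [mul_pow, div_pow]
  field_simp

/-- The `Lᵖ` bound for a frequency-localized piece of a heat flow at scale `R` and time `t`. -/
lemma exists_eLpNorm_heatFourier_le {p : ℝ} (hp : 1 ≤ p) (β : Fin n → ℕ) (l M : ℕ)
    {Φ : Rn n → ℂ} (hΦ : ∀ ξ, Φ ξ ≠ 0 → ‖ξ‖ ≤ 2 ∧ (1 / 2 ≤ ‖ξ‖ ∨ M = 0)) :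
    ∃ C : ℝ≥0, ∀ {R t : ℝ}, 0 < R → 0 < t → ∀ {g : Rn n → ℂ},
      (Integrable fun ξ => Φ (R⁻¹ • ξ) * g ξ) →
      eLpNorm (fun X => heatFourier (fun ξ => Φ (R⁻¹ • ξ) * (heatSymbol β l ξ * g ξ)) (X, t))
          (ENNReal.ofReal p) volume
        ≤ ENNReal.ofReal (R ^ (∑ k, β k + 2 * l) / (t * R ^ 2) ^ M) * C *
          eLpNorm (𝓕⁻ fun ξ => Φ (R⁻¹ • ξ) * g ξ) (ENNReal.ofReal p) volume := by
  obtain ⟨a, ha⟩ := exists_schwartzMap_heat_symbol n M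
  obtain ⟨b, hb⟩ := exists_schwartzMap_heatSymbol β l M
  have hfin : ∀ a : 𝓢(Rn n, ℂ), eLpNorm (𝓕⁻ (a : Rn n → ℂ)) 1 volume ≠ ⊤ := fun a => by
    rw [← SchwartzMap.fourierInv_coe]
    exact (SchwartzMap.eLpNorm_lt_top (𝓕⁻ a : 𝓢(Rn n, ℂ)) 1 volume).ne
  refine ⟨((eLpNorm (𝓕⁻ (a : Rn n → ℂ)) 1 volume) *
    (eLpNorm (𝓕⁻ (b : Rn n → ℂ)) 1 volume)).toNNReal, fun {R t} hR ht {g} hg => ?_⟩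
  rw [ENNReal.coe_toNNReal (ENNReal.mul_ne_top (hfin a) (hfin b))]
  set c : ℝ := R ^ (∑ k, β k + 2 * l) / (t * R ^ 2) ^ M with hc
  have hc0 : 0 ≤ c := by positivity
  have hfun : (fun X => heatFourier (fun ξ => Φ (R⁻¹ • ξ) * (heatSymbol β l ξ * g ξ)) (X, t))
      = (c : ℂ) • 𝓕⁻ fun ξ => a (√t • ξ) * (b (R⁻¹ • ξ) * (Φ (R⁻¹ • ξ) * g ξ)) := by
    ext X
    rw [heatFourier_eq_fourierInv, Pi.smul_apply, Real.fourierInv_eq, Real.fourierInv_eq,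
      ← integral_smul]
    congr 1
    ext ξ
    rw [smul_comm]
    congr 1
    by_cases h0 : Φ (R⁻¹ • ξ) = 0
    · simp [h0]
    · have key := heat_symbol_factorization (β := β) (l := l) ha hR ht (b := b) (ξ := ξ)
        (hb _ (hΦ _ h0).1 (hΦ _ h0).2)
      rw [smul_eq_mul]
      linear_combination (Φ (R⁻¹ • ξ) * g ξ) * key
  rw [hfun, eLpNorm_const_smul]
  have hce : ‖(c : ℂ)‖ₑ = ENNReal.ofReal c := by
    rw [← ofReal_norm, Complex.norm_real, Real.norm_of_nonneg hc0]
  rw [hce, mul_assoc, mul_assoc]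
  gcongr
  refine (eLpNorm_fourierInv_smul_mul_le hp a (integrable_schwartz_smul_mul b _ hg) _).trans ?_
  gcongr
  exact eLpNorm_fourierInv_smul_mul_le hp b hg _

end FrequencyPieces

section DyadicSummation

lemma summable_pow_natAbs {q : ℝ} (hq0 : 0 ≤ q) (hq1 : q < 1) :
    Summable fun m : ℤ => q ^ m.natAbs := by
  have h := summable_geometric_of_lt_one hq0 hq1
  refine .of_nat_of_neg ?_ ?_ <;> simpa using h

/-- A weight on `(0, ∞)` decaying at `0` and at `∞`. -/
def dyadicWeight (r s : ℝ) : ℝ := min s s⁻¹ ^ r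

lemma dyadicWeight_pos (r : ℝ) {s : ℝ} (hs : 0 < s) : 0 < dyadicWeight r s :=
  Real.rpow_pos_of_pos (lt_min hs (inv_pos.mpr hs)) _

lemma min_inv_le_zpow {s : ℝ} {m : ℤ} (h : s ∈ Set.Ico ((4 : ℝ) ^ m) (4 ^ (m + 1))) :
    min s s⁻¹ ≤ 4 * (4⁻¹ : ℝ) ^ m.natAbs := by
  have h4 : (0 : ℝ) < 4 ^ m := by positivity
  rcases le_or_gt 0 m with hm | hm
  · obtain ⟨k, rfl⟩ := Int.eq_ofNat_of_zero_le hm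
    have h1 : s⁻¹ ≤ (4⁻¹ : ℝ) ^ k := by
      rw [inv_pow]
      exact inv_anti₀ (by positivity) (by simpa using h.1)
    have h2 : (0 : ℝ) < (4⁻¹ : ℝ) ^ k := by positivity
    rw [Int.natAbs_natCast]
    exact (min_le_right _ _).trans (by linarith)
  · obtain ⟨k, rfl⟩ := Int.eq_negSucc_of_lt_zero hm
    refine (min_le_left _ _).trans (h.2.le.trans_eq ?_)
    rw [zpow_add₀ (by norm_num), zpow_negSucc, Int.natAbs_negSucc, inv_pow, zpow_one, mul_comm]

/-- Dyadic sums of the weight are bounded uniformly in the base point. -/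
lemma exists_tsum_dyadicWeight_le {r : ℝ} (hr : 0 < r) :
    ∃ S : ℝ≥0, ∀ t : ℝ, 0 < t →
      ∑' j : ℕ, ENNReal.ofReal (dyadicWeight r (t * 4 ^ (j + 1))) ≤ S := by
  set q : ℝ := (4⁻¹ : ℝ) ^ r with hq
  have hq1 : q < 1 := Real.rpow_lt_one (by norm_num) (by norm_num) hr
  have hq0 : 0 ≤ q := by positivity
  have hsum := (summable_pow_natAbs hq0 hq1).mul_left ((4 : ℝ) ^ r)
  refine ⟨(∑' m : ℤ, ENNReal.ofReal ((4 : ℝ) ^ r * q ^ m.natAbs)).toNNReal, fun t ht => ?_⟩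
  rw [ENNReal.coe_toNNReal]
  swap
  · rw [← ENNReal.ofReal_tsum_of_nonneg (fun m => by positivity) hsum]
    exact ENNReal.ofReal_ne_top
  obtain ⟨k, hk⟩ := exists_mem_Ico_zpow ht (by norm_num : (1 : ℝ) < 4)
  have hinj : Function.Injective fun j : ℕ => k + ((j : ℤ) + 1) := fun a b hab => by
    simpa using hab
  refine le_trans (ENNReal.tsum_le_tsum fun j => ?_)
    (ENNReal.tsum_comp_le_tsum_of_injective hinj _)
  refine ENNReal.ofReal_le_ofReal ?_
  have hs : 0 < t * 4 ^ (j + 1) := by positivity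
  have hmem : t * 4 ^ (j + 1) ∈
      Set.Ico ((4 : ℝ) ^ (k + ((j : ℤ) + 1))) (4 ^ (k + ((j : ℤ) + 1) + 1)) := by
    have e : (4 : ℝ) ^ (j + 1) = 4 ^ ((j : ℤ) + 1) := by norm_cast
    rw [e]
    constructor
    · rw [zpow_add₀ (by norm_num)]
      gcongr
      exact hk.1
    · rw [add_right_comm, zpow_add₀ (by norm_num) (k + 1)]
      gcongr
      exact hk.2
  refine (Real.rpow_le_rpow (le_min hs.le (inv_nonneg.mpr hs.le)) (min_inv_le_zpow hmem)
    hr.le).trans_eq ?_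
  rw [Real.mul_rpow (by norm_num) (by positivity), hq, ← Real.rpow_natCast, ← Real.rpow_natCast,
    ← Real.rpow_mul (by norm_num), ← Real.rpow_mul (by norm_num), mul_comm r]

/-- Weighted Hölder inequality for series. -/
lemma tsum_rpow_le_of_weight {p : ℝ} (hp : 1 ≤ p) {ω : ℕ → ℝ} (hω : ∀ j, 0 < ω j)
    (x : ℕ → ℝ≥0∞) :
    (∑' j, x j) ^ p ≤ (∑' j, ENNReal.ofReal (ω j)) ^ (p - 1) *
      ∑' j, ENNReal.ofReal (ω j ^ (1 - p)) * x j ^ p := by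
  have h := lintegral_mul_rpow_le (μ := (Measure.count : Measure ℕ)) hp
    (k := fun j => ENNReal.ofReal (ω j)) (g := fun j => ENNReal.ofReal (ω j)⁻¹ * x j)
    measurable_from_nat.aemeasurable measurable_from_nat.aemeasurable
  simp only [lintegral_count] at h
  have e1 : ∀ j, ENNReal.ofReal (ω j) * (ENNReal.ofReal (ω j)⁻¹ * x j) = x j := fun j => by
    rw [← mul_assoc, ← ENNReal.ofReal_mul (hω j).le, mul_inv_cancel₀ (hω j).ne',
      ENNReal.ofReal_one, one_mul]
  have e2 : ∀ j, ENNReal.ofReal (ω j) * (ENNReal.ofReal (ω j)⁻¹ * x j) ^ p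
      = ENNReal.ofReal (ω j ^ (1 - p)) * x j ^ p := fun j => by
    rw [ENNReal.mul_rpow_of_nonneg _ _ (by linarith),
      ENNReal.ofReal_rpow_of_pos (inv_pos.mpr (hω j)), ← mul_assoc,
      ← ENNReal.ofReal_mul (hω j).le, Real.inv_rpow (hω j).le, Real.rpow_sub (hω j),
      Real.rpow_one, div_eq_mul_inv]
  simpa only [e1, e2] using h

/-- The time weight arising from the decay of heat flows at a fixed frequency. -/
def timeWeight (p s : ℝ) : ℝ :=
  dyadicWeight (1 / p) s ^ (1 - p) * min 1 (s ^ 2)⁻¹ ^ p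

lemma measurable_timeWeight (p : ℝ) : Measurable (timeWeight p) := by
  unfold timeWeight dyadicWeight
  fun_prop

lemma timeWeight_of_le_one {p s : ℝ} (hs0 : 0 < s) (hs1 : s ≤ 1) :
    timeWeight p s = s ^ (1 / p * (1 - p)) := by
  have h1 : min s s⁻¹ = s := min_eq_left (hs1.trans ((one_le_inv₀ hs0).mpr hs1))
  have h2 : min 1 (s ^ 2)⁻¹ = 1 :=
    min_eq_left ((one_le_inv₀ (by positivity)).mpr (pow_le_one₀ hs0.le hs1))
  rw [timeWeight, dyadicWeight, h1, h2, Real.one_rpow, mul_one, ← Real.rpow_mul hs0.le]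

lemma timeWeight_of_one_le {p s : ℝ} (hs1 : 1 ≤ s) :
    timeWeight p s = s ^ (-(1 / p * (1 - p)) - 2 * p) := by
  have hs0 : 0 < s := by linarith
  have h1 : min s s⁻¹ = s⁻¹ := min_eq_right ((inv_le_one_of_one_le₀ hs1).trans hs1)
  have h2 : min 1 (s ^ 2)⁻¹ = (s ^ 2)⁻¹ :=
    min_eq_right (inv_le_one_of_one_le₀ (one_le_pow₀ hs1))
  rw [timeWeight, dyadicWeight, h1, h2, ← Real.rpow_mul (by positivity),
    Real.inv_rpow hs0.le, Real.inv_rpow (by positivity), ← Real.rpow_neg hs0.le,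
    ← Real.rpow_natCast, ← Real.rpow_mul hs0.le, ← Real.rpow_neg hs0.le, ← Real.rpow_add hs0]
  push_cast
  ring_nf

lemma lintegral_timeWeight_lt_top {p : ℝ} (hp : 1 ≤ p) :
    ∫⁻ s in Set.Ioi (0 : ℝ), ENNReal.ofReal (timeWeight p s) < ⊤ := by
  have hp0 : 0 < p := by linarith
  have hexp : 1 / p * (1 - p) = 1 / p - 1 := by field_simp
  have hinv : 0 < 1 / p := by positivity
  rw [← Set.Ioc_union_Ioi_eq_Ioi zero_le_one]
  refine (lintegral_union_le _ _ _).trans_lt (ENNReal.add_lt_top.mpr ⟨?_, ?_⟩)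
  · have h : IntegrableOn (fun s : ℝ => s ^ (1 / p * (1 - p))) (Set.Ioc 0 1) := by
      rw [← intervalIntegrable_iff_integrableOn_Ioc_of_le zero_le_one]
      exact intervalIntegral.intervalIntegrable_rpow' (by linarith)
    refine lt_of_eq_of_lt (setLIntegral_congr_fun measurableSet_Ioc fun s hs => ?_)
      h.lintegral_lt_top
    rw [timeWeight_of_le_one hs.1 hs.2]
  · have h : IntegrableOn (fun s : ℝ => s ^ (-(1 / p * (1 - p)) - 2 * p)) (Set.Ioi 1) :=
      integrableOn_Ioi_rpow_of_lt (by linarith) one_pos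
    refine lt_of_eq_of_lt (setLIntegral_congr_fun measurableSet_Ioi fun s hs => ?_)
      h.lintegral_lt_top
    rw [timeWeight_of_one_le (le_of_lt hs)]

lemma lintegral_Ioi_comp_mul_right {F : ℝ → ℝ≥0∞} (hF : Measurable F) {c : ℝ} (hc : 0 < c) :
    ∫⁻ t in Set.Ioi (0 : ℝ), F (t * c) = ENNReal.ofReal c⁻¹ * ∫⁻ s in Set.Ioi (0 : ℝ), F s := by
  have h := setLIntegral_map (μ := volume) (g := fun t : ℝ => t * c)
    (measurableSet_Ioi (a := (0 : ℝ))) hF (by fun_prop)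
  have hpre : (fun t : ℝ => t * c) ⁻¹' Set.Ioi 0 = Set.Ioi 0 := by
    ext t
    simp [hc]
  rw [hpre, Real.map_volume_mul_right hc.ne', Measure.restrict_smul, lintegral_smul_measure,
    abs_of_pos (inv_pos.mpr hc), smul_eq_mul] at h
  exact h.symm

/-- Time integration of a series of dyadic pieces with heat decay. -/
lemma exists_lintegral_tsum_rpow_le {α : Type*} [MeasurableSpace α] (μ : Measure α) {p : ℝ}
    (hp : 1 ≤ p) :
    ∃ K : ℝ≥0, ∀ (v : ℕ → α × ℝ → ℝ≥0∞) (D : ℕ → ℝ≥0∞),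
      (∀ j t, 0 < t → AEMeasurable (fun x => v j (x, t)) μ) →
      (∀ j t, 0 < t → ∫⁻ x, v j (x, t) ^ p ∂μ
        ≤ ENNReal.ofReal (min 1 ((t * 4 ^ (j + 1)) ^ 2)⁻¹ ^ p) * D j) →
      ∫⁻ t in Set.Ioi (0 : ℝ), ∫⁻ x, (∑' j, v j (x, t)) ^ p ∂μ
        ≤ K * ∑' j : ℕ, ENNReal.ofReal ((4 : ℝ) ^ (j + 1))⁻¹ * D j := by
  have hp0 : 0 < p := by linarith
  obtain ⟨S, hS⟩ := exists_tsum_dyadicWeight_le (r := 1 / p) (by positivity)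
  have hI := lintegral_timeWeight_lt_top hp
  set J := ∫⁻ s in Set.Ioi (0 : ℝ), ENNReal.ofReal (timeWeight p s) with hJ
  have hSp : (S : ℝ≥0∞) ^ (p - 1) ≠ ⊤ :=
    ENNReal.rpow_ne_top_of_nonneg (by linarith) ENNReal.coe_ne_top
  refine ⟨((S : ℝ≥0∞) ^ (p - 1) * J).toNNReal, fun v D hv hD => ?_⟩
  rw [ENNReal.coe_toNNReal (ENNReal.mul_ne_top hSp hI.ne)]
  have hslice : ∀ t : ℝ, 0 < t → ∫⁻ x, (∑' j, v j (x, t)) ^ p ∂μ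
      ≤ (S : ℝ≥0∞) ^ (p - 1) *
        ∑' j : ℕ, ENNReal.ofReal (timeWeight p (t * 4 ^ (j + 1))) * D j := by
    intro t ht
    have hpos : ∀ j : ℕ, 0 < t * 4 ^ (j + 1) := fun j => by positivity
    set ω : ℕ → ℝ := fun j => dyadicWeight (1 / p) (t * 4 ^ (j + 1)) with hω
    have hω0 : ∀ j, 0 < ω j := fun j => dyadicWeight_pos _ (hpos j)
    calc ∫⁻ x, (∑' j, v j (x, t)) ^ p ∂μ
        ≤ ∫⁻ x, (S : ℝ≥0∞) ^ (p - 1) *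
            ∑' j, ENNReal.ofReal (ω j ^ (1 - p)) * v j (x, t) ^ p ∂μ := by
          refine lintegral_mono fun x => (tsum_rpow_le_of_weight hp hω0 _).trans ?_
          exact mul_le_mul_left (ENNReal.rpow_le_rpow (hS t ht) (by linarith)) _
      _ = (S : ℝ≥0∞) ^ (p - 1) *
            ∑' j, ENNReal.ofReal (ω j ^ (1 - p)) * ∫⁻ x, v j (x, t) ^ p ∂μ := by
          rw [lintegral_const_mul' _ _ hSp, lintegral_tsum fun j =>
            ((hv j t ht).pow_const p).const_mul _]
          simp_rw [lintegral_const_mul' _ _ ENNReal.ofReal_ne_top]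
      _ ≤ _ := by
          refine mul_le_mul_right (ENNReal.tsum_le_tsum fun j => ?_) _
          refine (mul_le_mul_right (hD j t ht) _).trans_eq ?_
          rw [← mul_assoc, ← ENNReal.ofReal_mul (Real.rpow_nonneg (hω0 j).le _)]
          rfl
  have hmeas : ∀ c : ℝ, Measurable fun t : ℝ => ENNReal.ofReal (timeWeight p (t * c)) := fun c =>
    ((measurable_timeWeight p).comp (by fun_prop : Measurable fun t : ℝ => t * c)).ennreal_ofReal
  calc ∫⁻ t in Set.Ioi (0 : ℝ), ∫⁻ x, (∑' j, v j (x, t)) ^ p ∂μ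
      ≤ ∫⁻ t in Set.Ioi (0 : ℝ), (S : ℝ≥0∞) ^ (p - 1) *
        ∑' j : ℕ, ENNReal.ofReal (timeWeight p (t * 4 ^ (j + 1))) * D j :=
        setLIntegral_mono' measurableSet_Ioi fun t ht => hslice t ht
    _ = (S : ℝ≥0∞) ^ (p - 1) * ∑' j : ℕ, ENNReal.ofReal ((4 : ℝ) ^ (j + 1))⁻¹ * J * D j := by
        rw [lintegral_const_mul' _ _ hSp, lintegral_tsum fun j =>
          ((hmeas _).mul_const _).aemeasurable]
        congr 2
        ext j
        rw [lintegral_mul_const _ (hmeas _),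
          lintegral_Ioi_comp_mul_right (measurable_timeWeight p).ennreal_ofReal (by positivity)]
    _ = _ := by
        rw [mul_assoc, ← ENNReal.tsum_mul_left (a := J)]
        congr 1
        refine tsum_congr fun j => ?_
        ring

end DyadicSummation

section HeatEstimate

variable {n : ℕ}

lemma eLpNorm_ofReal_rpow {α E : Type*} [MeasurableSpace α] [NormedAddCommGroup E] {p : ℝ}
    (hp : 0 < p) (f : α → E) (μ : Measure α) :
    eLpNorm f (ENNReal.ofReal p) μ ^ p = ∫⁻ x, ‖f x‖ₑ ^ p ∂μ := by
  rw [eLpNorm_eq_lintegral_rpow_enorm_toReal (by simpa using hp) ENNReal.ofReal_ne_top,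
    ENNReal.toReal_ofReal hp.le, ← ENNReal.rpow_mul, one_div, inv_mul_cancel₀ hp.ne',
    ENNReal.rpow_one]

lemma stripMeasure_ofReal (n : ℕ) (T : ℝ) :
    stripMeasure n (ENNReal.ofReal T)
      = (volume : Measure (Rn n)).prod (volume.restrict (Set.Ioo 0 T)) := by
  have hset : {x : Rn1 n | x.2 ∈ tSet (ENNReal.ofReal T)} = Set.univ ×ˢ Set.Ioo 0 T := by
    ext x
    simp only [tSet, Set.mem_ofPred_eq, Set.mem_prod, Set.mem_univ, true_and, Set.mem_Ioo]
    refine and_congr_right fun h => ?_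
    rw [ENNReal.ofReal_lt_ofReal_iff_of_nonneg h.le]
  rw [stripMeasure, hset, Measure.volume_eq_prod, ← Measure.prod_restrict, Measure.restrict_univ]

lemma eLpNorm_stripMeasure_rpow {p : ℝ} (hp : 0 < p) (T : ℝ) {G : Rn1 n → ℂ}
    (hG : ContinuousOn G {x | 0 < x.2}) :
    eLpNorm G (ENNReal.ofReal p) (stripMeasure n (ENNReal.ofReal T)) ^ p
      = ∫⁻ t in Set.Ioo 0 T, ∫⁻ X : Rn n, ‖G (X, t)‖ₑ ^ p := by
  have hm : AEStronglyMeasurable G (stripMeasure n (ENNReal.ofReal T)) := by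
    have h : AEStronglyMeasurable G (volume.restrict {x : Rn1 n | 0 < x.2}) :=
      hG.aestronglyMeasurable (measurableSet_lt measurable_const measurable_snd)
    exact h.mono_measure (Measure.restrict_mono (fun x hx => hx.1) le_rfl)
  rw [eLpNorm_ofReal_rpow hp]
  rw [stripMeasure_ofReal] at hm ⊢
  rw [lintegral_prod_symm _ (hm.enorm.pow_const p)]

lemma continuous_slice_heatFourier {h : Rn n → ℂ} (hh : MomentIntegrable h) {t : ℝ} (ht : 0 < t) :
    Continuous fun X : Rn n => heatFourier h (X, t) :=
  (continuousOn_heatFourier hh).comp_continuous (by fun_prop) fun _ => ht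

lemma dyadic_rpow_identity {p : ℝ} (hp : 0 < p) (i j : ℕ) :
    ((4 : ℝ) ^ (j + 1))⁻¹ * (((4 : ℝ) ^ (j + 1)) ^ i) ^ p
      = ((2 : ℝ) ^ ((2 * (i : ℝ) - 2 / p) * ((j : ℝ) + 1))) ^ p := by
  have h4 : (4 : ℝ) = 2 ^ (2 : ℝ) := by norm_num
  have h2 : (0 : ℝ) ≤ 2 := by norm_num
  rw [← Real.rpow_natCast, ← Real.rpow_natCast, h4, ← Real.rpow_mul h2, ← Real.rpow_mul h2,
    ← Real.rpow_mul h2, ← Real.rpow_mul h2, ← Real.rpow_neg h2, ← Real.rpow_add (by norm_num)]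
  congr 1
  push_cast
  field_simp
  ring

/-- The `Lᵖ` bound on one Littlewood–Paley piece of a derivative of a heat extension. -/
lemma exists_eLpNorm_heat_piece_le (P : LPFamily n) {p : ℝ} (hp : 1 ≤ p) {i : ℕ}
    {β : Fin n → ℕ} {l : ℕ} (hk : ∑ k, β k + 2 * l ≤ 2 * i) :
    ∃ C : ℝ≥0, ∀ (f : 𝓢(Rn n, ℂ)) (j : ℕ) {t : ℝ}, 0 < t →
      eLpNorm (fun X => heatFourier
          (fun ξ => 𝓕 (P.φ : Rn n → ℂ) (((2 : ℝ) ^ (j + 1))⁻¹ • ξ) *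
            (heatSymbol β l ξ * 𝓕 (f : Rn n → ℂ) ξ)) (X, t)) (ENNReal.ofReal p) volume
        ≤ ENNReal.ofReal (min 1 ((t * 4 ^ (j + 1)) ^ 2)⁻¹) *
          (ENNReal.ofReal (((4 : ℝ) ^ (j + 1)) ^ i) * C *
            eLpNorm (convn (lpPhin P (j + 1)) f) (ENNReal.ofReal p) volume) := by
  have hφ : ∀ M : ℕ, ∀ ξ, 𝓕 (P.φ : Rn n → ℂ) ξ ≠ 0 → ‖ξ‖ ≤ 2 ∧ (1 / 2 ≤ ‖ξ‖ ∨ M = 0) := by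
    intro M ξ hξ
    by_contra hcon
    refine hξ (fourier_phi_eq_zero P fun h => hcon ⟨h.2.le, Or.inl h.1.le⟩)
  obtain ⟨C₀, hC₀⟩ := exists_eLpNorm_heatFourier_le hp β l 0 (hφ 0)
  obtain ⟨C₂, hC₂⟩ := exists_eLpNorm_heatFourier_le hp β l 2 (hφ 2)
  refine ⟨max C₀ C₂, fun f j {t} ht => ?_⟩
  have hR : (0 : ℝ) < 2 ^ (j + 1) := by positivity
  have hR1 : (1 : ℝ) ≤ 2 ^ (j + 1) := one_le_pow₀ (by norm_num)
  have hg : Integrable fun ξ => 𝓕 (P.φ : Rn n → ℂ) (((2 : ℝ) ^ (j + 1))⁻¹ • ξ) *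
      𝓕 (f : Rn n → ℂ) ξ := by
    have h := momentIntegrable_schwartz (𝓕 f)
    rw [SchwartzMap.fourier_coe] at h
    exact (h.fourier_schwartz_smul_mul P.φ _).integrable
  have h0 := hC₀ hR ht hg
  have h2 := hC₂ hR ht hg
  rw [← convn_lpPhin] at h0 h2
  have hR4 : ((2 : ℝ) ^ (j + 1)) ^ 2 = 4 ^ (j + 1) := by
    rw [← pow_mul, mul_comm, pow_mul]
    norm_num
  have hpow : ((2 : ℝ) ^ (j + 1)) ^ (∑ k, β k + 2 * l) ≤ ((4 : ℝ) ^ (j + 1)) ^ i := by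
    rw [← hR4, ← pow_mul ((2 : ℝ) ^ (j + 1)) 2 i]
    exact pow_le_pow_right₀ hR1 hk
  rw [hR4] at h0 h2
  rcases min_choice (1 : ℝ) ((t * 4 ^ (j + 1)) ^ 2)⁻¹ with hmin | hmin
  · rw [hmin, ENNReal.ofReal_one, one_mul]
    refine h0.trans ?_
    rw [pow_zero, div_one]
    gcongr
    exact le_max_left _ _
  · rw [hmin]
    refine h2.trans ?_
    rw [div_eq_inv_mul, ENNReal.ofReal_mul (by positivity), mul_assoc, mul_assoc, mul_assoc]
    gcongr
    exact le_max_right _ _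

lemma exists_eLpNorm_heat_low_le (P : LPFamily n) {p : ℝ} (hp : 1 ≤ p) (β : Fin n → ℕ) (l : ℕ) :
    ∃ C : ℝ≥0, ∀ (f : 𝓢(Rn n, ℂ)) {t : ℝ}, 0 < t →
      eLpNorm (fun X => heatFourier
          (fun ξ => 𝓕 (P.ψ : Rn n → ℂ) ξ * (heatSymbol β l ξ * 𝓕 (f : Rn n → ℂ) ξ)) (X, t))
          (ENNReal.ofReal p) volume
        ≤ C * eLpNorm (convn P.ψ f) (ENNReal.ofReal p) volume := by
  have hψ : ∀ ξ, 𝓕 (P.ψ : Rn n → ℂ) ξ ≠ 0 → ‖ξ‖ ≤ 2 ∧ (1 / 2 ≤ ‖ξ‖ ∨ (0 : ℕ) = 0) := by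
    intro ξ hξ
    refine ⟨?_, Or.inr rfl⟩
    by_contra! hcon
    exact hξ (fourier_psi_eq_zero P hcon.le)
  obtain ⟨C, hC⟩ := exists_eLpNorm_heatFourier_le hp β l 0 hψ
  refine ⟨C, fun f {t} ht => ?_⟩
  have hg : Integrable fun ξ => 𝓕 (P.ψ : Rn n → ℂ) ((1 : ℝ)⁻¹ • ξ) * 𝓕 (f : Rn n → ℂ) ξ := by
    have h := momentIntegrable_schwartz (𝓕 f)
    rw [SchwartzMap.fourier_coe] at h
    exact (h.fourier_schwartz_smul_mul P.ψ _).integrable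
  simpa [convn_schwartz] using hC one_pos ht hg

/-- The `Lᵖ` bound on one derivative of a heat extension. -/
lemma exists_eLpNorm_dXmulti_dT_heatExt_le (P : LPFamily n) {p : ℝ} (hp : 1 ≤ p) {T : ℝ}
    {i : ℕ} {β : Fin n → ℕ} {l : ℕ} (hk : ∑ k, β k + 2 * l ≤ 2 * i) :
    ∃ C : ℝ≥0, ∀ f : 𝓢(Rn n, ℂ),
      eLpNorm (dXmulti β (dT^[l] (heatExt f))) (ENNReal.ofReal p)
          (stripMeasure n (ENNReal.ofReal T))
        ≤ C * besovN P (2 * (i : ℝ) - 2 / p) p f := by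
  have hp0 : 0 < p := by linarith
  obtain ⟨A, hA⟩ := exists_eLpNorm_heat_low_le P hp β l
  obtain ⟨B, hB⟩ := exists_eLpNorm_heat_piece_le P hp hk
  obtain ⟨K, hK⟩ := exists_lintegral_tsum_rpow_le (volume : Measure (Rn n)) hp
  set L : ℝ≥0∞ := 2 ^ (p - 1) * (ENNReal.ofReal T * (A : ℝ≥0∞) ^ p + K * (B : ℝ≥0∞) ^ p) with hL
  have hLtop : L ≠ ⊤ := by
    have h1 : (2 : ℝ≥0∞) ^ (p - 1) ≠ ⊤ :=
      ENNReal.rpow_ne_top_of_nonneg (by linarith) ENNReal.ofNat_ne_top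
    have h2 : ∀ x : ℝ≥0, (x : ℝ≥0∞) ^ p ≠ ⊤ := fun x =>
      ENNReal.rpow_ne_top_of_nonneg hp0.le ENNReal.coe_ne_top
    exact ENNReal.mul_ne_top h1 (ENNReal.add_ne_top.mpr
      ⟨ENNReal.mul_ne_top ENNReal.ofReal_ne_top (h2 A),
        ENNReal.mul_ne_top ENNReal.coe_ne_top (h2 B)⟩)
  refine ⟨(L ^ (1 / p)).toNNReal, fun f => ?_⟩
  rw [ENNReal.coe_toNNReal (ENNReal.rpow_ne_top_of_nonneg (by positivity) hLtop)]
  have hf : MomentIntegrable (𝓕 (f : Rn n → ℂ)) := by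
    rw [← SchwartzMap.fourier_coe]
    exact momentIntegrable_schwartz _
  obtain ⟨hH, hEq⟩ := dXmulti_iterate_dT_eqOn hf (heatExt_eqOn f) β l
  set H : Rn n → ℂ := fun ξ => heatSymbol β l ξ * 𝓕 (f : Rn n → ℂ) ξ with hHdef
  set v : ℕ → Rn1 n → ℝ≥0∞ := fun j z =>
    ‖heatFourier (fun ξ => 𝓕 (P.φ : Rn n → ℂ) (((2 : ℝ) ^ (j + 1))⁻¹ • ξ) * H ξ) z‖ₑ with hv
  set a := eLpNorm (convn P.ψ f) (ENNReal.ofReal p) volume with ha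
  set d : ℕ → ℝ≥0∞ := fun j => eLpNorm (convn (lpPhin P (j + 1)) f) (ENNReal.ofReal p) volume
    with hd
  set D : ℕ → ℝ≥0∞ := fun j => (ENNReal.ofReal (((4 : ℝ) ^ (j + 1)) ^ i) * B * d j) ^ p with hD
  set Q := ∑' j : ℕ,
    (ENNReal.ofReal ((2 : ℝ) ^ ((2 * (i : ℝ) - 2 / p) * ((j : ℝ) + 1))) * d j) ^ p with hQ
  have hcont : ContinuousOn (dXmulti β (dT^[l] (heatExt f))) {x | 0 < x.2} :=
    (continuousOn_heatFourier hH).congr hEq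
  have hhigh : ∫⁻ t in Set.Ioo 0 T, ∫⁻ X : Rn n, (∑' j, v j (X, t)) ^ p
      ≤ K * ((B : ℝ≥0∞) ^ p * Q) := by
    refine (lintegral_mono_set Set.Ioo_subset_Ioi_self).trans
      ((hK v D (fun j t ht => ?_) fun j t ht => ?_).trans_eq ?_)
    · exact (continuous_slice_heatFourier (hH.fourier_schwartz_smul_mul P.φ _)
        ht).enorm.measurable.aemeasurable
    · rw [← eLpNorm_ofReal_rpow hp0,
        ← ENNReal.ofReal_rpow_of_nonneg (le_min zero_le_one (by positivity)) hp0.le,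
        ← ENNReal.mul_rpow_of_nonneg _ _ hp0.le]
      exact ENNReal.rpow_le_rpow (hB f j ht) hp0.le
    · rw [hQ, ← ENNReal.tsum_mul_left (a := (B : ℝ≥0∞) ^ p)]
      refine congrArg _ (tsum_congr fun j => ?_)
      simp only [hD, ENNReal.mul_rpow_of_nonneg _ _ hp0.le]
      rw [ENNReal.ofReal_rpow_of_nonneg (by positivity) hp0.le,
        ENNReal.ofReal_rpow_of_nonneg (by positivity) hp0.le, ← dyadic_rpow_identity hp0,
        ENNReal.ofReal_mul (by positivity)]
      ring
  have hslice : ∀ t ∈ Set.Ioo 0 T, ∫⁻ X : Rn n, ‖dXmulti β (dT^[l] (heatExt f)) (X, t)‖ₑ ^ p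
      ≤ 2 ^ (p - 1) * ((A * a) ^ p + ∫⁻ X : Rn n, (∑' j, v j (X, t)) ^ p) := by
    intro t ht
    have hψ : MomentIntegrable fun ξ => 𝓕 (P.ψ : Rn n → ℂ) ξ * H ξ := by
      simpa using hH.fourier_schwartz_smul_mul P.ψ 1
    calc ∫⁻ X : Rn n, ‖dXmulti β (dT^[l] (heatExt f)) (X, t)‖ₑ ^ p
        ≤ ∫⁻ X : Rn n, 2 ^ (p - 1) *
            (‖heatFourier (fun ξ => 𝓕 (P.ψ : Rn n → ℂ) ξ * H ξ) (X, t)‖ₑ ^ p +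
              (∑' j, v j (X, t)) ^ p) := by
          refine lintegral_mono fun X => ?_
          rw [hEq (show (0 : ℝ) < t from ht.1)]
          exact (ENNReal.rpow_le_rpow (enorm_heatFourier_le P hH.integrable ht.1.le)
            hp0.le).trans (ENNReal.rpow_add_le_mul_rpow_add_rpow _ _ hp)
      _ = 2 ^ (p - 1) *
            ((∫⁻ X : Rn n, ‖heatFourier (fun ξ => 𝓕 (P.ψ : Rn n → ℂ) ξ * H ξ) (X, t)‖ₑ ^ p) +
              ∫⁻ X : Rn n, (∑' j, v j (X, t)) ^ p) := by
          rw [lintegral_const_mul' _ _ (ENNReal.rpow_ne_top_of_nonneg (by linarith)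
            ENNReal.ofNat_ne_top), lintegral_add_left]
          exact ((continuous_slice_heatFourier hψ ht.1).enorm.measurable).pow_const p
      _ ≤ _ := by
          rw [← eLpNorm_ofReal_rpow hp0]
          gcongr
          exact hA f ht.1
  have hmain : eLpNorm (dXmulti β (dT^[l] (heatExt f))) (ENNReal.ofReal p)
      (stripMeasure n (ENNReal.ofReal T)) ^ p ≤ L * (a ^ p + Q) := by
    rw [eLpNorm_stripMeasure_rpow hp0 T hcont]
    refine (setLIntegral_mono' measurableSet_Ioo hslice).trans ?_
    rw [lintegral_const_mul' _ _ (ENNReal.rpow_ne_top_of_nonneg (by linarith)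
      ENNReal.ofNat_ne_top), lintegral_add_left measurable_const, setLIntegral_const,
      Real.volume_Ioo, sub_zero, hL, mul_assoc]
    refine mul_le_mul_right ?_ _
    rw [ENNReal.mul_rpow_of_nonneg _ _ hp0.le]
    calc (A : ℝ≥0∞) ^ p * a ^ p * ENNReal.ofReal T +
          ∫⁻ t in Set.Ioo 0 T, ∫⁻ X : Rn n, (∑' j, v j (X, t)) ^ p
        ≤ ENNReal.ofReal T * (A : ℝ≥0∞) ^ p * a ^ p + K * (B : ℝ≥0∞) ^ p * Q := by
          refine add_le_add (le_of_eq (by ring)) (hhigh.trans_eq (by ring))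
      _ ≤ (ENNReal.ofReal T * (A : ℝ≥0∞) ^ p + K * (B : ℝ≥0∞) ^ p) * a ^ p +
          (ENNReal.ofReal T * (A : ℝ≥0∞) ^ p + K * (B : ℝ≥0∞) ^ p) * Q := by
          gcongr
          · exact le_self_add
          · exact le_add_self
      _ = _ := by rw [mul_add]
  have hroot := ENNReal.rpow_le_rpow hmain (by positivity : 0 ≤ 1 / p)
  rw [← ENNReal.rpow_mul, mul_one_div_cancel hp0.ne', ENNReal.rpow_one,
    ENNReal.mul_rpow_of_nonneg _ _ (by positivity)] at hroot
  refine hroot.trans (mul_le_mul_right ?_ _)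
  refine (ENNReal.rpow_add_le_add_rpow _ _ (by positivity)
    ((div_le_one hp0).mpr hp)).trans_eq ?_
  rw [← ENNReal.rpow_mul, mul_one_div_cancel hp0.ne', ENNReal.rpow_one]
  rfl

end HeatEstimate

end

/-- `‖u‖_{W^{2i,i}_p(ℝⁿ_T)} ≲ B_{2i−2/p,p}(f)` for the heat extension `u`. -/
theorem stmt16 (n : ℕ) (hn : 1 ≤ n) (p : ℝ) (hp : 1 ≤ p) (T : ℝ) (hT : 0 < T) (i : ℕ)
    (P : LPFamily n) :
    ∃ C : ℝ, 0 < C ∧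
      ∀ f : SchwartzMap (Rn n) ℂ,
        wNorm i p (ENNReal.ofReal T) (heatExt ⇑f)
          ≤ ENNReal.ofReal C * besovN P (2 * (i : ℝ) - 2 / p) p ⇑f := by
  have hmain : ∀ (l : ℕ) (β : Fin n → ℕ), ∃ C : ℝ≥0, ∑ k, β k + 2 * l ≤ 2 * i →
      ∀ f : SchwartzMap (Rn n) ℂ,
        eLpNorm (dXmulti β (dT^[l] (heatExt f))) (ENNReal.ofReal p)
            (stripMeasure n (ENNReal.ofReal T))
          ≤ C * besovN P (2 * (i : ℝ) - 2 / p) p f := by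
    intro l β
    by_cases hk : ∑ k, β k + 2 * l ≤ 2 * i
    · obtain ⟨C, hC⟩ := exists_eLpNorm_dXmulti_dT_heatExt_le P hp (T := T) hk
      exact ⟨C, fun _ => hC⟩
    · exact ⟨0, fun h => absurd h hk⟩
  choose C hC using hmain
  let S : ℝ≥0 := ∑ l ∈ Finset.range (i + 1),
    ∑ β ∈ (Fintype.piFinset fun _ : Fin n => Finset.range (2 * i + 1)).filter
        (fun β => (∑ k, β k) + 2 * l ≤ 2 * i), C l β
  refine ⟨(S + 1 : ℝ≥0), by positivity, fun f => ?_⟩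
  rw [ENNReal.ofReal_coe_nnreal]
  calc wNorm i p (ENNReal.ofReal T) (heatExt f)
      ≤ (S : ℝ≥0∞) * besovN P (2 * (i : ℝ) - 2 / p) p f := by
        simp only [S, wNorm, ENNReal.ofNNReal_finsetSum, Finset.sum_mul]
        exact Finset.sum_le_sum fun l _ => Finset.sum_le_sum fun β hβ =>
          hC l β (Finset.mem_filter.mp hβ).2 f
    _ ≤ _ := by
        gcongr
        exact le_self_add
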